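/- arXiv:1104.3237 — 2 statements merged into one kernel-verified Lean document; each statement's English description precedes it below -/
import Mathlib

section
/- Let (ν_n) be a sequence of strictly aperiodic probability measures on ℤ such that E(ν_n) = 0 for all n, such that φ(n) = ∑_{i=1}^n m₂(ν_i) = O(n), and such that there exist a constant C > 0 and an integer N₀ > 0 with |ν̂_n(t)| ≤ e^{−Ct²} for all n > N₀ and all t ∈ [−1/2, 1/2). Set μ_n = ν_1∗⋯∗ν_n. Then the maximal operator Mf(x) = sup_n |μ_n f(x)| is of weak type (1,1): there exists a constant C' > 0 such that for every invertible measure-preserving transformation τ of a probability space (X, B, m), every f ∈ L¹(X), and every λ > 0, m{x ∈ X : Mf(x) > λ} ≤ (C'/λ)‖f‖₁. -/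
open scoped BigOperators
open Filter MeasureTheory

/-- A probability measure on `ℤ`, given as a nonnegative function summing to `1`. -/
def IsProbMeasure (ν : ℤ → ℝ) : Prop := (∀ k, 0 ≤ ν k) ∧ HasSum ν 1

/-- The Fourier transform `ν̂(t) = ∑_{k ∈ ℤ} ν(k) e^{2πikt}`. -/
noncomputable def ft (ν : ℤ → ℝ) (t : ℝ) : ℂ :=
  ∑' k : ℤ, (ν k : ℂ) * Complex.exp (2 * Real.pi * Complex.I * (k : ℂ) * (t : ℂ))

/-- Convolution of two measures on `ℤ`. -/
noncomputable def conv (μ ν : ℤ → ℝ) (k : ℤ) : ℝ := ∑' j : ℤ, μ (k - j) * ν j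

/-- `muN ν n = ν 0 ∗ ν 1 ∗ ⋯ ∗ ν n`. -/
noncomputable def muN (ν : ℕ → ℤ → ℝ) : ℕ → ℤ → ℝ
  | 0 => ν 0
  | n + 1 => conv (muN ν n) (ν (n + 1))

/-- The expectation `E(ν) = ∑ k ν(k)`. -/
noncomputable def expectation (ν : ℤ → ℝ) : ℝ := ∑' k : ℤ, (k : ℝ) * ν k

/-- The second moment `m₂(ν)`. -/
noncomputable def m2 (ν : ℤ → ℝ) : ℝ := ∑' k : ℤ, |(k : ℝ)| ^ 2 * ν k

/-- The first moment `m₁(ν)`. -/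
noncomputable def m1 (ν : ℤ → ℝ) : ℝ := ∑' k : ℤ, |(k : ℝ)| * ν k

/-- `ν` is strictly aperiodic: its support is not contained in any proper coset `r + βℤ`. -/
def StrictlyAperiodic (ν : ℤ → ℝ) : Prop :=
  ∀ β r : ℤ, β.natAbs ≠ 1 → ∃ k : ℤ, ν k ≠ 0 ∧ ¬ β ∣ (k - r)

/-- The mass `ν(βℤ + r)` that `ν` gives to the coset `βℤ + r`. -/
noncomputable def cosetMass (ν : ℤ → ℝ) (β r : ℤ) : ℝ :=
  ∑' k : ℤ, if β ∣ (k - r) then ν k else 0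

lemma norm_char (k : ℤ) (t : ℝ) :
    ‖Complex.exp (2 * Real.pi * Complex.I * (k : ℂ) * (t : ℂ))‖ = 1 := by
  rw [Complex.norm_exp]
  simp

lemma norm_ft_term (a : ℤ → ℝ) (t : ℝ) (k : ℤ) :
    ‖(a k : ℂ) * Complex.exp (2 * Real.pi * Complex.I * (k : ℂ) * (t : ℂ))‖ = |a k| := by
  rw [norm_mul, norm_char, mul_one, Complex.norm_real, Real.norm_eq_abs]

lemma summable_ft {a : ℤ → ℝ} (ha : Summable a) (t : ℝ) :
    Summable fun k : ℤ =>
      (a k : ℂ) * Complex.exp (2 * Real.pi * Complex.I * (k : ℂ) * (t : ℂ)) :=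
  Summable.of_norm (by simpa only [norm_ft_term] using ha.abs)

lemma norm_ft_le {a : ℤ → ℝ} (ha : Summable a) (t : ℝ) : ‖ft a t‖ ≤ ∑' k, |a k| := by
  have h : Summable fun k : ℤ =>
      ‖(a k : ℂ) * Complex.exp (2 * Real.pi * Complex.I * (k : ℂ) * (t : ℂ))‖ := by
    simpa only [norm_ft_term] using ha.abs
  simpa only [norm_ft_term, ft] using norm_tsum_le_tsum_norm h

lemma ft_add {a b : ℤ → ℝ} (ha : Summable a) (hb : Summable b) (t : ℝ) :
    ft (fun k => a k + b k) t = ft a t + ft b t := by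
  unfold ft
  rw [← (summable_ft ha t).tsum_add (summable_ft hb t)]
  congr 1
  ext k
  push_cast
  ring

lemma ft_sub {a b : ℤ → ℝ} (ha : Summable a) (hb : Summable b) (t : ℝ) :
    ft (fun k => a k - b k) t = ft a t - ft b t := by
  unfold ft
  rw [← (summable_ft ha t).tsum_sub (summable_ft hb t)]
  congr 1
  ext k
  push_cast
  ring

lemma ft_shift (a : ℤ → ℝ) (t : ℝ) :
    ft (fun k => a (k + 1)) t
      = Complex.exp (Complex.I * ((-(2 * Real.pi * t) : ℝ) : ℂ)) * ft a t := by
  unfold ft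
  rw [← tsum_mul_left, ← (Equiv.addRight (1 : ℤ)).tsum_eq (fun k : ℤ =>
    Complex.exp (Complex.I * ((-(2 * Real.pi * t) : ℝ) : ℂ)) *
      ((a k : ℂ) * Complex.exp (2 * Real.pi * Complex.I * (k : ℂ) * (t : ℂ))))]
  congr 1
  ext k
  simp only [Equiv.coe_addRight]
  rw [mul_left_comm, ← Complex.exp_add]
  congr 2
  push_cast
  ring

/-- The shear `(k, j) ↦ (k - j, j)` of `ℤ × ℤ`. -/
def shear : ℤ × ℤ ≃ ℤ × ℤ where
  toFun p := (p.1 - p.2, p.2)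
  invFun p := (p.1 + p.2, p.2)
  left_inv p := by simp
  right_inv p := by simp

lemma summable_shear {a b : ℤ → ℝ} (ha : Summable a) (hb : Summable b) :
    Summable fun p : ℤ × ℤ => a (p.1 - p.2) * b p.2 :=
  shear.summable_iff.mpr (summable_mul_of_summable_norm ha.norm hb.norm)

lemma summable_conv_term {a b : ℤ → ℝ} (ha : Summable a) (hb : Summable b) (k : ℤ) :
    Summable fun j => a (k - j) * b j :=
  (summable_shear ha hb).prod_factor k

lemma summable_conv {a b : ℤ → ℝ} (ha : Summable a) (hb : Summable b) :
    Summable (conv a b) :=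
  (summable_shear ha hb).prod

lemma ft_conv {a b : ℤ → ℝ} (ha : Summable a) (hb : Summable b) (t : ℝ) :
    ft (conv a b) t = ft a t * ft b t := by
  have hA := (summable_ft ha t).norm
  have hB := (summable_ft hb t).norm
  have hs := shear.summable_iff.mpr (summable_mul_of_summable_norm hA hB)
  unfold ft
  rw [tsum_mul_tsum_of_summable_norm hA hB, ← shear.tsum_eq]
  refine Eq.trans ?_ hs.tsum_prod.symm
  congr 1
  ext k
  simp only [conv, Complex.ofReal_tsum, Function.comp, shear, Equiv.coe_fn_mk]
  rw [← tsum_mul_right]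
  congr 1
  ext j
  rw [mul_mul_mul_comm, ← Complex.exp_add]
  push_cast
  congr 2
  ring

lemma tsum_conv {a b : ℤ → ℝ} (ha : Summable a) (hb : Summable b) :
    ∑' k, conv a b k = (∑' k, a k) * ∑' k, b k := by
  rw [tsum_mul_tsum_of_summable_norm ha.norm hb.norm, ← shear.tsum_eq]
  exact (summable_shear ha hb).tsum_prod.symm

/-- Multiplication of a sequence on `ℤ` by the coordinate. -/
def coordMul (a : ℤ → ℝ) (k : ℤ) : ℝ := k * a k

lemma coordMul_conv {a b : ℤ → ℝ} (ha : Summable a) (hb : Summable b)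
    (ha' : Summable (coordMul a)) (hb' : Summable (coordMul b)) :
    coordMul (conv a b) = fun k => conv (coordMul a) b k + conv a (coordMul b) k := by
  ext k
  simp only [conv]
  rw [← (summable_conv_term ha' hb k).tsum_add (summable_conv_term ha hb' k), coordMul, conv,
    ← tsum_mul_left]
  congr 1
  ext j
  simp only [coordMul]
  push_cast
  ring

lemma coordMul_add (a b : ℤ → ℝ) :
    coordMul (fun k => a k + b k) = fun k => coordMul a k + coordMul b k := by
  ext k
  simp only [coordMul]
  ring

/-- Fourier inversion for summable sequences. -/
lemma integral_ft_mul_char {a : ℤ → ℝ} (ha : Summable a) (x : ℤ) :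
    ∫ t in (-(1 / 2) : ℝ)..(1 / 2),
      ft a t * Complex.exp (2 * Real.pi * Complex.I * ((-x : ℤ) : ℂ) * (t : ℂ)) = a x := by
  have key := intervalIntegral.hasSum_integral_of_dominated_convergence (a := -(1 / 2 : ℝ))
    (b := 1 / 2) (μ := volume)
    (F := fun (k : ℤ) (t : ℝ) =>
      (a k : ℂ) * Complex.exp (2 * Real.pi * Complex.I * (k : ℂ) * (t : ℂ)) *
        Complex.exp (2 * Real.pi * Complex.I * ((-x : ℤ) : ℂ) * (t : ℂ)))
    (f := fun t =>
      ft a t * Complex.exp (2 * Real.pi * Complex.I * ((-x : ℤ) : ℂ) * (t : ℂ)))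
    (fun k _ => |a k|)
    (fun k => (Continuous.aestronglyMeasurable (by fun_prop)))
    (fun k => ae_of_all _ fun t _ => by rw [norm_mul, norm_ft_term, norm_char, mul_one])
    (ae_of_all _ fun t _ => ha.abs)
    (by simp)
    (ae_of_all _ fun t _ => (summable_ft ha t).hasSum.mul_right _)
  rw [← key.tsum_eq, tsum_eq_single x]
  · have : ∀ t : ℝ, (a x : ℂ) * Complex.exp (2 * Real.pi * Complex.I * (x : ℂ) * (t : ℂ)) *
        Complex.exp (2 * Real.pi * Complex.I * ((-x : ℤ) : ℂ) * (t : ℂ)) = a x := by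
      intro t
      rw [mul_assoc, ← Complex.exp_add]
      push_cast
      rw [show 2 * (Real.pi : ℂ) * Complex.I * (x : ℂ) * (t : ℂ) +
        2 * Real.pi * Complex.I * (-x : ℂ) * (t : ℂ) = 0 by ring]
      simp
    simp only [this]
    rw [intervalIntegral.integral_const]
    norm_num
  · intro k hk
    have hc : 2 * (Real.pi : ℂ) * Complex.I * ((k - x : ℤ) : ℂ) ≠ 0 := by
      refine mul_ne_zero Complex.two_pi_I_ne_zero ?_
      exact_mod_cast sub_ne_zero.mpr hk
    have : ∀ t : ℝ, (a k : ℂ) * Complex.exp (2 * Real.pi * Complex.I * (k : ℂ) * (t : ℂ)) *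
        Complex.exp (2 * Real.pi * Complex.I * ((-x : ℤ) : ℂ) * (t : ℂ))
        = a k * Complex.exp (2 * (Real.pi : ℂ) * Complex.I * ((k - x : ℤ) : ℂ) * t) := by
      intro t
      rw [mul_assoc, ← Complex.exp_add]
      congr 2
      push_cast
      ring
    simp only [this]
    rw [intervalIntegral.integral_const_mul, integral_exp_mul_complex hc]
    have h2 : Complex.exp (2 * (Real.pi : ℂ) * Complex.I * ((k - x : ℤ) : ℂ) * ((1 / 2 : ℝ) : ℂ))
        = Complex.exp
          (2 * (Real.pi : ℂ) * Complex.I * ((k - x : ℤ) : ℂ) * ((-(1 / 2) : ℝ) : ℂ)) := by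
      rw [Complex.exp_eq_exp_iff_exists_int]
      refine ⟨k - x, ?_⟩
      push_cast
      ring
    rw [h2]
    simp

lemma abs_le_integral_of_norm_ft_le {a : ℤ → ℝ} (ha : Summable a) {g : ℝ → ℝ}
    (hg : Continuous g)
    (h : ∀ t ∈ Set.Ico (-(1 : ℝ) / 2) (1 / 2), ‖ft a t‖ ≤ g t) (x : ℤ) :
    |a x| ≤ ∫ t in (-(1 / 2) : ℝ)..(1 / 2), g t := by
  rw [← Real.norm_eq_abs, ← Complex.norm_real, ← integral_ft_mul_char ha x]
  refine intervalIntegral.norm_integral_le_of_norm_le (by norm_num) ?_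
    (hg.intervalIntegrable _ _)
  have : ∀ᵐ t : ℝ, t ≠ 1 / 2 := by simp [ae_iff]
  filter_upwards [this] with t ht hmem
  rw [norm_mul, norm_char, mul_one]
  exact h t ⟨by linarith [hmem.1], lt_of_le_of_ne hmem.2 ht⟩

lemma coordMul_coordMul_eq (a : ℤ → ℝ) :
    coordMul (coordMul a) = fun k : ℤ => |(k : ℝ)| ^ 2 * a k := by
  ext k
  simp only [coordMul, sq_abs]
  ring

lemma abs_int_le_sq (k : ℤ) : |(k : ℝ)| ≤ |(k : ℝ)| ^ 2 := by
  have : |k| ≤ |k| ^ 2 := by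
    rcases eq_or_ne k 0 with rfl | hk
    · simp
    · have := Int.one_le_abs hk
      nlinarith
  exact_mod_cast this

lemma summable_coordMul {a : ℤ → ℝ} (ha : ∀ k, 0 ≤ a k)
    (h : Summable fun k : ℤ => |(k : ℝ)| ^ 2 * a k) : Summable (coordMul a) := by
  refine Summable.of_norm_bounded h fun k => ?_
  rw [coordMul, Real.norm_eq_abs, abs_mul, abs_of_nonneg (ha k)]
  exact mul_le_mul_of_nonneg_right (abs_int_le_sq k) (ha k)

lemma norm_ft_prob_le_one {a : ℤ → ℝ} (ha : IsProbMeasure a) (t : ℝ) : ‖ft a t‖ ≤ 1 := by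
  refine (norm_ft_le ha.2.summable t).trans_eq ?_
  simp only [abs_of_nonneg (ha.1 _)]
  exact ha.2.tsum_eq

lemma m2_nonneg {a : ℤ → ℝ} (ha : ∀ k, 0 ≤ a k) : 0 ≤ m2 a :=
  tsum_nonneg fun k => mul_nonneg (by positivity) (ha k)

lemma norm_ft_coordMul_coordMul_le {a : ℤ → ℝ} (ha : ∀ k, 0 ≤ a k)
    (h : Summable fun k : ℤ => |(k : ℝ)| ^ 2 * a k) (t : ℝ) :
    ‖ft (coordMul (coordMul a)) t‖ ≤ m2 a := by
  rw [coordMul_coordMul_eq]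
  refine (norm_ft_le h t).trans_eq ?_
  unfold m2
  congr 1
  ext k
  exact abs_of_nonneg (mul_nonneg (by positivity) (ha k))

lemma norm_ft_coordMul_le {a : ℤ → ℝ} (ha : ∀ k, 0 ≤ a k)
    (h : Summable fun k : ℤ => |(k : ℝ)| ^ 2 * a k) (hE : expectation a = 0) (t : ℝ) :
    ‖ft (coordMul a) t‖ ≤ 2 * Real.pi * |t| * m2 a := by
  have hs := summable_coordMul ha h
  have h0 : ∑' k : ℤ, ((coordMul a k : ℝ) : ℂ) = 0 := by
    rw [← Complex.ofReal_tsum]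
    exact_mod_cast hE
  have hs' : Summable fun k : ℤ => ((coordMul a k : ℝ) : ℂ) := by exact_mod_cast hs
  have : ft (coordMul a) t = ∑' k : ℤ, (coordMul a k : ℂ) *
      (Complex.exp (Complex.I * ((2 * Real.pi * k * t : ℝ) : ℂ)) - 1) := by
    rw [← sub_zero (ft _ t), ← h0, ft, ← (summable_ft hs t).tsum_sub hs']
    congr 1
    ext k
    rw [mul_sub, mul_one]
    congr 3
    push_cast
    ring
  rw [this, m2]
  have hsum := (h.mul_left (2 * Real.pi * |t|)).hasSum
  rw [tsum_mul_left] at hsum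
  refine tsum_of_norm_bounded hsum fun k => ?_
  rw [norm_mul, Complex.norm_real, coordMul, Real.norm_eq_abs, abs_mul, abs_of_nonneg (ha k)]
  have h1 := Real.norm_exp_I_mul_ofReal_sub_one_le (x := 2 * Real.pi * k * t)
  rw [Real.norm_eq_abs, abs_mul, abs_mul, abs_of_pos Real.two_pi_pos] at h1
  calc _ ≤ |(k : ℝ)| * a k * (2 * Real.pi * |(k : ℝ)| * |t|) :=
        mul_le_mul_of_nonneg_left h1 (mul_nonneg (abs_nonneg _) (ha k))
    _ = _ := by ring

lemma IsProbMeasure.conv {a b : ℤ → ℝ} (ha : IsProbMeasure a) (hb : IsProbMeasure b) :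
    IsProbMeasure (conv a b) := by
  refine ⟨fun k => tsum_nonneg fun j => mul_nonneg (ha.1 _) (hb.1 _), ?_⟩
  have := (summable_conv ha.2.summable hb.2.summable).hasSum
  rwa [tsum_conv ha.2.summable hb.2.summable, ha.2.tsum_eq, hb.2.tsum_eq, mul_one] at this

lemma isProbMeasure_muN {ν : ℕ → ℤ → ℝ} (hprob : ∀ n, IsProbMeasure (ν n)) (n : ℕ) :
    IsProbMeasure (muN ν n) := by
  induction n with
  | zero => exact hprob 0
  | succ n ih => exact ih.conv (hprob _)

lemma coordMul_coordMul_conv {a b : ℤ → ℝ} (ha : Summable a) (hb : Summable b)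
    (ha1 : Summable (coordMul a)) (hb1 : Summable (coordMul b))
    (ha2 : Summable (coordMul (coordMul a))) (hb2 : Summable (coordMul (coordMul b))) :
    coordMul (coordMul (conv a b)) = fun k =>
      (conv (coordMul (coordMul a)) b k + conv (coordMul a) (coordMul b) k) +
        (conv (coordMul a) (coordMul b) k + conv a (coordMul (coordMul b)) k) := by
  rw [coordMul_conv ha hb ha1 hb1, coordMul_add, coordMul_conv ha1 hb ha2 hb1,
    coordMul_conv ha hb1 ha1 hb2]

/-- The first two moments of `μ_n` converge. -/
lemma summable_coordMul_muN {ν : ℕ → ℤ → ℝ} (hprob : ∀ n, IsProbMeasure (ν n))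
    (hm2 : ∀ n, Summable fun k : ℤ => |(k : ℝ)| ^ 2 * ν n k) (n : ℕ) :
    Summable (coordMul (muN ν n)) ∧ Summable (coordMul (coordMul (muN ν n))) := by
  have h0 := fun n => (hprob n).2.summable
  have h1 := fun n => summable_coordMul (hprob n).1 (hm2 n)
  have h2 : ∀ n, Summable (coordMul (coordMul (ν n))) := fun n => by
    rw [coordMul_coordMul_eq]; exact hm2 n
  induction n with
  | zero => exact ⟨h1 0, h2 0⟩
  | succ n ih =>
    have hμ := (isProbMeasure_muN hprob n).2.summable
    rw [muN, coordMul_coordMul_conv hμ (h0 _) ih.1 (h1 _) ih.2 (h2 _),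
      coordMul_conv hμ (h0 _) ih.1 (h1 _)]
    exact ⟨(summable_conv ih.1 (h0 _)).add (summable_conv hμ (h1 _)),
      ((summable_conv ih.2 (h0 _)).add (summable_conv ih.1 (h1 _))).add
        ((summable_conv ih.1 (h1 _)).add (summable_conv hμ (h2 _)))⟩

lemma ft_coordMul_conv {a b : ℤ → ℝ} (ha : Summable a) (hb : Summable b)
    (ha1 : Summable (coordMul a)) (hb1 : Summable (coordMul b)) (t : ℝ) :
    ft (coordMul (conv a b)) t = ft (coordMul a) t * ft b t + ft a t * ft (coordMul b) t := by
  rw [coordMul_conv ha hb ha1 hb1, ft_add (summable_conv ha1 hb) (summable_conv ha hb1),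
    ft_conv ha1 hb, ft_conv ha hb1]

lemma ft_coordMul_coordMul_conv {a b : ℤ → ℝ} (ha : Summable a) (hb : Summable b)
    (ha1 : Summable (coordMul a)) (hb1 : Summable (coordMul b))
    (ha2 : Summable (coordMul (coordMul a))) (hb2 : Summable (coordMul (coordMul b))) (t : ℝ) :
    ft (coordMul (coordMul (conv a b))) t = ft (coordMul (coordMul a)) t * ft b t +
      2 * (ft (coordMul a) t * ft (coordMul b) t) + ft a t * ft (coordMul (coordMul b)) t := by
  have s1 := summable_conv ha2 hb
  have s2 := summable_conv ha1 hb1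
  have s3 := summable_conv ha hb2
  rw [coordMul_coordMul_conv ha hb ha1 hb1 ha2 hb2, ft_add (s1.add s2) (s2.add s3),
    ft_add s1 s2, ft_add s2 s3, ft_conv ha2 hb, ft_conv ha1 hb1, ft_conv ha hb2]
  ring

/-- Pointwise bounds for the Fourier transforms of `μ_n`, `k μ_n` and `k² μ_n`, in terms of
bounds `b i` for the transforms of the factors. -/
lemma norm_ft_muN_le {ν : ℕ → ℤ → ℝ} (hprob : ∀ n, IsProbMeasure (ν n))
    (hE : ∀ n, expectation (ν n) = 0)
    (hm2 : ∀ n, Summable fun k : ℤ => |(k : ℝ)| ^ 2 * ν n k) {t q : ℝ} (hq : 0 ≤ q)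
    {b : ℕ → ℝ} (hb : ∀ i, ‖ft (ν i) t‖ ≤ b i) (hqb : ∀ i, 1 ≤ q * b i) (n : ℕ) :
    ‖ft (muN ν n) t‖ ≤ ∏ i ∈ Finset.range (n + 1), b i ∧
    ‖ft (coordMul (muN ν n)) t‖ ≤ 2 * Real.pi * |t| * (q * ∑ i ∈ Finset.range (n + 1), m2 (ν i)) *
      ∏ i ∈ Finset.range (n + 1), b i ∧
    ‖ft (coordMul (coordMul (muN ν n))) t‖ ≤ (q * (∑ i ∈ Finset.range (n + 1), m2 (ν i)) +
      (2 * Real.pi * |t| * (q * ∑ i ∈ Finset.range (n + 1), m2 (ν i))) ^ 2) *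
      ∏ i ∈ Finset.range (n + 1), b i := by
  have h0 := fun n => (hprob n).2.summable
  have h1 := fun n => summable_coordMul (hprob n).1 (hm2 n)
  have h2 : ∀ n, Summable (coordMul (coordMul (ν n))) := fun n => by
    rw [coordMul_coordMul_eq]; exact hm2 n
  have hm := fun i => m2_nonneg (hprob i).1
  have f1 := fun i => norm_ft_coordMul_le (hprob i).1 (hm2 i) (hE i) t
  have f2 := fun i => norm_ft_coordMul_coordMul_le (hprob i).1 (hm2 i) t
  have hb0 : ∀ i, 0 ≤ b i := fun i => (norm_nonneg _).trans (hb i)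
  have hθ : 0 ≤ 2 * Real.pi * |t| := by positivity
  set θ := 2 * Real.pi * |t|
  induction n with
  | zero =>
    simp only [zero_add, Finset.range_one, Finset.sum_singleton, Finset.prod_singleton, muN]
    have hqb0 := mul_le_mul_of_nonneg_left (hqb 0) (hm 0)
    refine ⟨hb 0, (f1 0).trans ?_, (f2 0).trans ?_⟩
    · have := mul_le_mul_of_nonneg_left hqb0 hθ
      linarith
    · have : 0 ≤ (θ * (q * m2 (ν 0))) ^ 2 * b 0 := mul_nonneg (sq_nonneg _) (hb0 0)
      linarith
  | succ n ih =>
    obtain ⟨i0, i1, i2⟩ := ih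
    obtain ⟨s1, s2⟩ := summable_coordMul_muN hprob hm2 n
    have hμ := (isProbMeasure_muN hprob n).2.summable
    rw [Finset.sum_range_succ _ (n + 1), Finset.prod_range_succ _ (n + 1), muN,
      ft_conv hμ (h0 _), ft_coordMul_conv hμ (h0 _) s1 (h1 _),
      ft_coordMul_coordMul_conv hμ (h0 _) s1 (h1 _) s2 (h2 _)]
    have hφ : 0 ≤ ∑ i ∈ Finset.range (n + 1), m2 (ν i) := Finset.sum_nonneg fun i _ => hm i
    have hP : 0 ≤ ∏ i ∈ Finset.range (n + 1), b i := Finset.prod_nonneg fun i _ => hb0 i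
    set φ := ∑ i ∈ Finset.range (n + 1), m2 (ν i)
    set P := ∏ i ∈ Finset.range (n + 1), b i
    have hm' := hm (n + 1)
    have hβ := hb0 (n + 1)
    have hqβ := hqb (n + 1)
    have hb' := hb (n + 1)
    have f1' := f1 (n + 1)
    have f2' := f2 (n + 1)
    set β := b (n + 1)
    set M := m2 (ν (n + 1))
    refine ⟨?_, ?_, ?_⟩
    · rw [norm_mul]
      exact mul_le_mul i0 hb' (norm_nonneg _) hP
    · calc _ ≤ θ * (q * φ) * P * β + P * (θ * M) * 1 := by
            refine (norm_add_le _ _).trans ?_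
            rw [norm_mul, norm_mul, mul_one]
            gcongr
        _ ≤ θ * (q * φ) * P * β + P * (θ * M) * (q * β) := by gcongr
        _ = _ := by ring
    · calc _ ≤ (q * φ + (θ * (q * φ)) ^ 2) * P * β + 2 * (θ * (q * φ) * P * (θ * M)) * 1
              + P * M * 1 := by
            refine (norm_add_le _ _).trans ?_
            refine (add_le_add_left (norm_add_le _ _) _).trans ?_
            simp only [norm_mul, mul_one, Complex.norm_ofNat]
            gcongr
        _ ≤ (q * φ + (θ * (q * φ)) ^ 2) * P * β + 2 * (θ * (q * φ) * P * (θ * M)) * (q * β)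
              + P * M * (q * β) := by gcongr
        _ ≤ (q * φ + (θ * (q * φ)) ^ 2) * P * β + 2 * (θ * (q * φ) * P * (θ * M)) * (q * β)
              + P * M * (q * β) + (θ * (q * M)) ^ 2 * (P * β) :=
            le_add_of_nonneg_right (by positivity)
        _ = _ := by ring

lemma integral_abs_mul_exp_le {c N : ℝ} (hc : 0 < c) (hN : 0 < N) :
    ∫ t in (-(1 / 2) : ℝ)..(1 / 2), N * |t| * Real.exp (-(c * (N * t ^ 2))) ≤ 1 / c := by
  have hcont : Continuous fun t : ℝ => N * |t| * Real.exp (-(c * (N * t ^ 2))) := by fun_prop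
  have hder : ∀ t : ℝ, HasDerivAt (fun t : ℝ => Real.exp (-(c * (N * t ^ 2))) / (2 * c))
      (-(N * t * Real.exp (-(c * (N * t ^ 2))))) t := by
    intro t
    have h := (((((hasDerivAt_pow 2 t).const_mul N).const_mul c).neg).exp).div_const (2 * c)
    refine h.congr_deriv ?_
    field_simp
    norm_num
    ring
  have hd' : Continuous fun t : ℝ => -(N * t * Real.exp (-(c * (N * t ^ 2)))) := by fun_prop
  rw [← intervalIntegral.integral_add_adjacent_intervals (b := 0)
    (hcont.intervalIntegrable _ _) (hcont.intervalIntegrable _ _)]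
  have e1 : ∫ t in (-(1 / 2) : ℝ)..0, N * |t| * Real.exp (-(c * (N * t ^ 2)))
      = ∫ t in (-(1 / 2) : ℝ)..0, -(N * t * Real.exp (-(c * (N * t ^ 2)))) := by
    refine intervalIntegral.integral_congr fun t ht => ?_
    rw [Set.uIcc_of_le (by norm_num)] at ht
    simp only [abs_of_nonpos ht.2]
    ring
  have e2 : ∫ t in (0 : ℝ)..(1 / 2), N * |t| * Real.exp (-(c * (N * t ^ 2)))
      = -∫ t in (0 : ℝ)..(1 / 2), -(N * t * Real.exp (-(c * (N * t ^ 2)))) := by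
    rw [← intervalIntegral.integral_neg]
    refine intervalIntegral.integral_congr fun t ht => ?_
    rw [Set.uIcc_of_le (by norm_num)] at ht
    simp only [abs_of_nonneg ht.1]
    ring
  rw [e1, e2, intervalIntegral.integral_eq_sub_of_hasDerivAt (fun t _ => hder t)
    (hd'.intervalIntegrable _ _), intervalIntegral.integral_eq_sub_of_hasDerivAt (fun t _ => hder t)
    (hd'.intervalIntegrable _ _)]
  have h1 : Real.exp (-(c * (N * (0 : ℝ) ^ 2))) / (2 * c) = 1 / c / 2 := by
    simp
    ring
  have h2 : ∀ t : ℝ, 0 ≤ Real.exp (-(c * (N * t ^ 2))) / (2 * c) := fun t => by positivity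
  rw [h1]
  linarith [h2 (-(1 / 2)), h2 (1 / 2)]

lemma prod_ite_exp_le {q y : ℝ} (hq : 1 ≤ q) (hy : 0 ≤ y) (hqy : 1 ≤ q * y) (N₀ n : ℕ) :
    ∏ i ∈ Finset.range n, (if i ≤ N₀ then 1 else y) ≤ q ^ (N₀ + 1) * y ^ n := by
  calc ∏ i ∈ Finset.range n, (if i ≤ N₀ then 1 else y)
      ≤ ∏ i ∈ Finset.range n, (if i ≤ N₀ then q else 1) * y := by
        refine Finset.prod_le_prod (fun i _ => by split_ifs <;> positivity) fun i _ => ?_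
        split_ifs <;> simp [hqy]
    _ = q ^ (Finset.card {i ∈ Finset.range n | i ≤ N₀}) * y ^ n := by
        rw [Finset.prod_mul_distrib, Finset.prod_ite]
        simp
    _ ≤ _ := by
        refine mul_le_mul_of_nonneg_right (pow_le_pow_right₀ hq ?_) (by positivity)
        rw [← Finset.card_range (N₀ + 1)]
        refine Finset.card_le_card fun i hi => ?_
        simp only [Finset.mem_filter, Finset.mem_range] at hi ⊢
        omega

/-- The regularity estimate `|μ_n(x+1) - μ_n(x)| ≤ A / x²`, uniformly in `n`. -/
lemma exists_sq_mul_abs_sub_le {ν : ℕ → ℤ → ℝ} (hprob : ∀ n, IsProbMeasure (ν n))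
    (hE : ∀ n, expectation (ν n) = 0)
    (hm2 : ∀ n, Summable fun k : ℤ => |(k : ℝ)| ^ 2 * ν n k)
    (hφ : ∃ K : ℝ, ∀ n : ℕ, ∑ i ∈ Finset.range (n + 1), m2 (ν i) ≤ K * (n + 1))
    {C : ℝ} (hC : 0 < C) {N₀ : ℕ}
    (hft : ∀ n > N₀, ∀ t ∈ Set.Ico (-(1 : ℝ) / 2) (1 / 2),
      ‖ft (ν n) t‖ ≤ Real.exp (-C * t ^ 2)) :
    ∃ A : ℝ, ∀ (n : ℕ) (x : ℤ), (x : ℝ) ^ 2 * |muN ν n (x + 1) - muN ν n x| ≤ A := by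
  obtain ⟨K, hK⟩ := hφ
  have hK0 : 0 ≤ K := by
    have := hK 0
    simp only [zero_add, Finset.range_one, Finset.sum_singleton, Nat.cast_zero, mul_one] at this
    exact (m2_nonneg (hprob 0).1).trans this
  set q := Real.exp (C / 4) with hq
  have hq1 : 1 ≤ q := Real.one_le_exp (by positivity)
  have hq0 : 0 ≤ q := zero_le_one.trans hq1
  set Q := q ^ (N₀ + 1)
  have hQ0 : 0 ≤ Q := by positivity
  set B₁ := 2 * Real.pi * (q * K) * Q with hB₁
  set B₂ := 2 * Real.pi * (q * K + (2 * Real.pi * (q * K)) ^ 2 * (2 / C)) * Q with hB₂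
  refine ⟨B₂ * (1 / (C / 2)) + 2 * (B₁ * (1 / (C / 2))) + 1, fun n x => ?_⟩
  have hN : (0 : ℝ) < n + 1 := by positivity
  have hP := isProbMeasure_muN hprob n
  obtain ⟨s1, s2⟩ := summable_coordMul_muN hprob hm2 n
  have bound : ∀ t ∈ Set.Ico (-(1 : ℝ) / 2) (1 / 2),
      ‖ft (coordMul (muN ν n)) t‖ ≤ 2 * Real.pi * |t| * (q * (K * (n + 1))) *
        (Q * Real.exp (-(C * ((n + 1) * t ^ 2)))) ∧
      ‖ft (coordMul (coordMul (muN ν n))) t‖ ≤ (q * (K * (n + 1)) +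
        (2 * Real.pi * |t| * (q * (K * (n + 1)))) ^ 2) *
        (Q * Real.exp (-(C * ((n + 1) * t ^ 2)))) := by
    intro t ht
    have ht2 : t ^ 2 ≤ 1 / 4 := by nlinarith [ht.1, ht.2]
    have hqy : 1 ≤ q * Real.exp (-C * t ^ 2) := by
      rw [hq, ← Real.exp_add]
      exact Real.one_le_exp (by nlinarith)
    obtain ⟨-, h1, h2⟩ := norm_ft_muN_le hprob hE hm2 (t := t) hq0
      (b := fun i => if i ≤ N₀ then 1 else Real.exp (-C * t ^ 2))
      (fun i => by
        split_ifs with hi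
        · exact norm_ft_prob_le_one (hprob i) t
        · exact hft i (not_le.mp hi) t ht)
      (fun i => by
        split_ifs
        · simpa using hq1
        · exact hqy) n
    have hprod := prod_ite_exp_le hq1 (Real.exp_nonneg (-C * t ^ 2)) hqy N₀ (n + 1)
    rw [← Real.exp_nat_mul (-C * t ^ 2) (n + 1), show ((n + 1 : ℕ) : ℝ) * (-C * t ^ 2) = -(C * ((n + 1) * t ^ 2)) by
      push_cast; ring] at hprod
    have hnn : 0 ≤ ∏ i ∈ Finset.range (n + 1), (if i ≤ N₀ then 1 else Real.exp (-C * t ^ 2)) :=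
      Finset.prod_nonneg fun i _ => by split_ifs <;> positivity
    have hs : 0 ≤ ∑ i ∈ Finset.range (n + 1), m2 (ν i) :=
      Finset.sum_nonneg fun i _ => m2_nonneg (hprob i).1
    have hKn := hK n
    refine ⟨h1.trans ?_, h2.trans ?_⟩ <;> gcongr
  have hexp : ∀ t : ℝ, Real.exp (-(C * ((n + 1) * t ^ 2)))
      ≤ Real.exp (-(C / 2 * ((n + 1) * t ^ 2))) := fun t =>
    Real.exp_le_exp.mpr (by nlinarith [mul_nonneg hN.le (sq_nonneg t)])
  have hexp2 : ∀ t : ℝ, ((n + 1) * t ^ 2) * Real.exp (-(C * ((n + 1) * t ^ 2)))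
      ≤ 2 / C * Real.exp (-(C / 2 * ((n + 1) * t ^ 2))) := fun t => by
    set w := (n + 1) * t ^ 2
    have h1 : C / 2 * w ≤ Real.exp (C / 2 * w) := by
      linarith [Real.add_one_le_exp (C / 2 * w)]
    have h2 : w ≤ 2 / C * Real.exp (C / 2 * w) := by
      calc w = 2 / C * (C / 2 * w) := by field_simp
        _ ≤ _ := by gcongr
    calc _ ≤ 2 / C * Real.exp (C / 2 * w) * Real.exp (-(C * w)) := by gcongr
      _ = _ := by rw [mul_assoc, ← Real.exp_add]; ring_nf
  have int_le : ∀ B : ℝ, 0 ≤ B → ∫ t in (-(1 / 2) : ℝ)..(1 / 2),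
      B * ((n + 1) * |t| * Real.exp (-(C / 2 * ((n + 1) * t ^ 2)))) ≤ B * (1 / (C / 2)) := by
    intro B hB
    rw [intervalIntegral.integral_const_mul]
    exact mul_le_mul_of_nonneg_left (integral_abs_mul_exp_le (by positivity) hN) hB
  have first : |coordMul (muN ν n) (x + 1)| ≤ B₁ * (1 / (C / 2)) := by
    refine (abs_le_integral_of_norm_ft_le s1 (g := fun t =>
      B₁ * ((n + 1) * |t| * Real.exp (-(C / 2 * ((n + 1) * t ^ 2))))) (by fun_prop)
      (fun t ht => ?_) _).trans (int_le _ (by positivity))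
    calc _ ≤ _ := (bound t ht).1
      _ = B₁ * ((n + 1) * |t| * Real.exp (-(C * ((n + 1) * t ^ 2)))) := by rw [hB₁]; ring
      _ ≤ _ := by gcongr B₁ * (_ * ?_); exact hexp t
  have s2' : Summable fun k => coordMul (coordMul (muN ν n)) (k + 1) :=
    (Equiv.addRight (1 : ℤ)).summable_iff.mpr s2
  have second : |coordMul (coordMul (muN ν n)) (x + 1) - coordMul (coordMul (muN ν n)) x|
      ≤ B₂ * (1 / (C / 2)) := by
    refine (abs_le_integral_of_norm_ft_le (s2'.sub s2) (g := fun t =>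
      B₂ * ((n + 1) * |t| * Real.exp (-(C / 2 * ((n + 1) * t ^ 2))))) (by fun_prop)
      (fun t ht => ?_) _).trans (int_le _ (by positivity))
    rw [ft_sub s2' s2, ft_shift, ← sub_one_mul, norm_mul]
    have h1 := Real.norm_exp_I_mul_ofReal_sub_one_le (x := -(2 * Real.pi * t))
    rw [Real.norm_eq_abs, abs_neg, abs_mul, abs_of_pos Real.two_pi_pos] at h1
    calc _ ≤ (2 * Real.pi * |t|) * ((q * (K * (n + 1)) +
        (2 * Real.pi * |t| * (q * (K * (n + 1)))) ^ 2) *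
        (Q * Real.exp (-(C * ((n + 1) * t ^ 2))))) := by
          gcongr
          exact (bound t ht).2
      _ = 2 * Real.pi * Q * ((n + 1) * |t|) *
          (q * K * Real.exp (-(C * ((n + 1) * t ^ 2))) + (2 * Real.pi * (q * K)) ^ 2 *
            (((n + 1) * t ^ 2) * Real.exp (-(C * ((n + 1) * t ^ 2))))) := by
          rw [← sq_abs t]; ring
      _ ≤ 2 * Real.pi * Q * ((n + 1) * |t|) *
          (q * K * Real.exp (-(C / 2 * ((n + 1) * t ^ 2))) + (2 * Real.pi * (q * K)) ^ 2 *
            (2 / C * Real.exp (-(C / 2 * ((n + 1) * t ^ 2))))) := by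
          gcongr 2 * Real.pi * Q * _ * (q * K * ?_ + _ * ?_)
          · exact hexp t
          · exact hexp2 t
      _ = _ := by rw [hB₂]; ring
  have third : |muN ν n (x + 1)| ≤ 1 := by
    rw [abs_of_nonneg (hP.1 _)]
    exact le_hasSum hP.2 _ fun k _ => hP.1 k
  have expand : (x : ℝ) ^ 2 * (muN ν n (x + 1) - muN ν n x) =
      (coordMul (coordMul (muN ν n)) (x + 1) - coordMul (coordMul (muN ν n)) x)
        - 2 * coordMul (muN ν n) (x + 1) + muN ν n (x + 1) := by
    simp only [coordMul]
    push_cast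
    ring
  rw [← abs_of_nonneg (sq_nonneg (x : ℝ)), ← abs_mul, expand]
  refine (abs_add_le _ _).trans (add_le_add ((abs_sub _ _).trans (add_le_add second ?_)) third)
  rw [abs_mul, abs_two]
  exact mul_le_mul_of_nonneg_left first zero_le_two

lemma sum_inv_sq_nat_le (V : Finset ℕ) (k : ℕ) (hV : ∀ i ∈ V, k < i) :
    ∑ i ∈ V, ((i : ℝ) ^ 2)⁻¹ ≤ 2 / (k + 1) := by
  refine le_trans (Finset.sum_le_sum_of_subset_of_nonneg (t := Finset.Ioo k (V.sup id + 1))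
    (fun i hi => ?_) fun i _ _ => by positivity) (sum_Ioo_inv_sq_le k (V.sup id + 1))
  exact Finset.mem_Ioo.mpr ⟨hV i hi, Nat.lt_succ_of_le (Finset.le_sup (f := id) hi)⟩

lemma sum_inv_sq_int_le (W : Finset ℤ) {l : ℕ} (hl : 0 < l) (hW : ∀ z ∈ W, (2 * l : ℤ) ≤ |z|) :
    ∑ z ∈ W, ((z : ℝ) ^ 2)⁻¹ ≤ 2 / l := by
  have half : ∀ U : Finset ℤ, U ⊆ W → Set.InjOn Int.natAbs (U : Set ℤ) →
      ∑ z ∈ U, ((z : ℝ) ^ 2)⁻¹ ≤ 1 / l := by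
    intro U hU hinj
    have e : ∑ z ∈ U, ((z : ℝ) ^ 2)⁻¹ = ∑ i ∈ U.image Int.natAbs, ((i : ℝ) ^ 2)⁻¹ := by
      rw [Finset.sum_image hinj]
      refine Finset.sum_congr rfl fun z _ => ?_
      rw [Nat.cast_natAbs, Int.cast_abs, sq_abs]
    rw [e]
    refine (sum_inv_sq_nat_le _ (2 * l - 1) fun i hi => ?_).trans_eq ?_
    · obtain ⟨z, hz, rfl⟩ := Finset.mem_image.mp hi
      have := hW z (hU hz)
      rw [Int.abs_eq_natAbs] at this
      omega
    · rw [Nat.cast_sub (by omega)]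
      push_cast
      field_simp
      ring
  rw [← Finset.sum_filter_add_sum_filter_not W (fun z => 0 ≤ z)]
  have h1 := half {z ∈ W | 0 ≤ z} (Finset.filter_subset _ _) (by
    intro a ha b hb hab
    simp only [Finset.coe_filter, Set.mem_ofPred_eq] at ha hb
    omega)
  have h2 := half {z ∈ W | ¬ 0 ≤ z} (Finset.filter_subset _ _) (by
    intro a ha b hb hab
    simp only [Finset.coe_filter, Set.mem_ofPred_eq] at ha hb
    omega)
  calc _ ≤ 1 / (l : ℝ) + 1 / l := add_le_add h1 h2
    _ = _ := by ring

/-- Oscillation over a short interval of a sequence whose increments decay quadratically. -/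
lemma abs_sub_le_of_increments {p : ℤ → ℝ} {A : ℝ}
    (hA : ∀ x : ℤ, (x : ℝ) ^ 2 * |p (x + 1) - p x| ≤ A) {l : ℕ} (hl : 0 < l) {z : ℤ}
    (hz : (2 * l : ℤ) ≤ |z|) {i : ℕ} (hi : i ≤ l) :
    |p (z + i) - p z| ≤ i * (4 * A / (z : ℝ) ^ 2) := by
  have hA0 : 0 ≤ A := by simpa using hA 0
  induction i with
  | zero => simp
  | succ i ih =>
    have hw : |z| ≤ 2 * |z + i| := by
      rw [Int.abs_eq_natAbs] at hz ⊢
      rw [Int.abs_eq_natAbs]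
      omega
    have hz0 : (0 : ℝ) < (z : ℝ) ^ 2 := by
      have : z ≠ 0 := by
        rintro rfl
        simp at hz
        omega
      positivity
    have hw2 : (z : ℝ) ^ 2 ≤ 4 * ((z + i : ℤ) : ℝ) ^ 2 := by
      have : z ^ 2 ≤ 4 * (z + i) ^ 2 := by
        rw [← sq_abs z, ← sq_abs (z + i)]
        nlinarith [abs_nonneg z]
      exact_mod_cast this
    have step : |p (z + i + 1) - p (z + i)| ≤ 4 * A / (z : ℝ) ^ 2 := by
      rw [le_div_iff₀ hz0]
      nlinarith [hA (z + i), abs_nonneg (p (z + i + 1) - p (z + i))]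
    have e : p (z + (i + 1 : ℕ)) - p z = (p (z + i + 1) - p (z + i)) + (p (z + i) - p z) := by
      push_cast
      rw [← add_assoc]
      ring
    rw [e]
    refine (abs_add_le _ _).trans ((add_le_add step (ih (by omega))).trans_eq ?_)
    push_cast
    ring

/-- On the interval `I`, the maximal function of `F` under the kernels `p n` is dominated, off a
finite set `E` with `lam * #E ≤ 4 ∑_I F`, by the one of the constant `2 * lam` up to an error `h`
of total mass at most `16 * A * ∑_I F`. -/
def HasMajorant (p : ℕ → ℤ → ℝ) (A lam : ℝ) (F : ℤ → ℝ) (I : Finset ℤ) : Prop :=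
  ∃ (E : Finset ℤ) (h : ℤ → ℝ),
    lam * E.card ≤ 4 * ∑ y ∈ I, F y ∧ (∀ x, 0 ≤ h x) ∧
    (∀ W : Finset ℤ, ∑ x ∈ W, h x ≤ 16 * A * ∑ y ∈ I, F y) ∧
    ∀ x ∉ E, ∀ n, ∑ y ∈ I, p n (y - x) * F y ≤ 2 * lam * ∑ y ∈ I, p n (y - x) + h x

lemma HasMajorant.union {p : ℕ → ℤ → ℝ} {A lam : ℝ} (hlam : 0 < lam) {F : ℤ → ℝ}
    {I I' : Finset ℤ} (hd : Disjoint I I') (hI : HasMajorant p A lam F I)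
    (hI' : HasMajorant p A lam F I') : HasMajorant p A lam F (I ∪ I') := by
  obtain ⟨E, h, a1, a2, a3, a4⟩ := hI
  obtain ⟨E', h', b1, b2, b3, b4⟩ := hI'
  refine ⟨E ∪ E', fun x => h x + h' x, ?_, fun x => add_nonneg (a2 x) (b2 x), fun W => ?_,
    fun x hx n => ?_⟩
  · have : ((E ∪ E').card : ℝ) ≤ E.card + E'.card := by exact_mod_cast Finset.card_union_le E E'
    rw [Finset.sum_union hd]
    nlinarith
  · rw [Finset.sum_union hd, Finset.sum_add_distrib]
    linarith [a3 W, b3 W]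
  · rw [Finset.notMem_union] at hx
    rw [Finset.sum_union hd, Finset.sum_union hd]
    linarith [a4 x hx.1 n, b4 x hx.2 n]

/-- The estimate on a single selected Calderón–Zygmund interval. -/
lemma hasMajorant_of_average {p : ℕ → ℤ → ℝ} {A : ℝ}
    (hA : ∀ (n : ℕ) (x : ℤ), (x : ℝ) ^ 2 * |p n (x + 1) - p n x| ≤ A)
    (hp : ∀ n x, 0 ≤ p n x) {lam : ℝ} {F : ℤ → ℝ} (hF : ∀ y, 0 ≤ F y)
    {l : ℕ} (hl : 0 < l) (s : ℤ)
    (h1 : lam * l ≤ ∑ y ∈ Finset.Ico s (s + l), F y)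
    (h2 : ∑ y ∈ Finset.Ico s (s + l), F y ≤ 2 * lam * l) :
    HasMajorant p A lam F (Finset.Ico s (s + l)) := by
  have hA0 : 0 ≤ A := by simpa using hA 0 0
  have hl' : (0 : ℝ) < l := by exact_mod_cast hl
  have hS : 0 ≤ ∑ y ∈ Finset.Ico s (s + l), F y := Finset.sum_nonneg fun y _ => hF y
  set S := ∑ y ∈ Finset.Ico s (s + l), F y with hSdef
  have hlam : 0 ≤ lam := by
    by_contra! hneg
    nlinarith
  set E := Finset.Ioo (s - 2 * l) (s + 2 * l) with hE
  have hEmem : ∀ x, x ∉ E → (2 * l : ℤ) ≤ |s - x| := fun x hx => by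
    rw [hE, Finset.mem_Ioo] at hx
    rw [Int.abs_eq_natAbs]
    omega
  refine ⟨E, fun x => if x ∈ E then 0 else 2 * S * (l * (4 * A / ((s - x : ℤ) : ℝ) ^ 2)),
    ?_, ?_, ?_, ?_⟩
  · have hcard : (E.card : ℝ) ≤ 4 * l := by
      have : E.card ≤ 4 * l := by
        rw [hE, Int.card_Ioo]
        omega
      exact_mod_cast this
    nlinarith
  · intro x
    dsimp only
    split_ifs <;> positivity
  · intro W
    rw [Finset.sum_ite, Finset.sum_const_zero, zero_add]
    have hinj : Set.InjOn (fun x : ℤ => s - x) ({x ∈ W | x ∉ E} : Finset ℤ) :=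
      fun a _ b _ hab => by simpa using hab
    have := sum_inv_sq_int_le (({x ∈ W | x ∉ E} : Finset ℤ).image fun x => s - x) hl (by
      intro z hz
      obtain ⟨x, hx, rfl⟩ := Finset.mem_image.mp hz
      exact hEmem x (Finset.mem_filter.mp hx).2)
    rw [Finset.sum_image hinj] at this
    calc _ = 8 * S * A * l * ∑ x ∈ W with x ∉ E, (((s - x : ℤ) : ℝ) ^ 2)⁻¹ := by
          rw [Finset.mul_sum _ _ (8 * S * A * l)]
          refine Finset.sum_congr rfl fun x _ => ?_
          ring
      _ ≤ 8 * S * A * l * (2 / l) := by gcongr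
      _ = _ := by field_simp; ring
  · intro x hx n
    simp only [if_neg hx]
    set δ := l * (4 * A / ((s - x : ℤ) : ℝ) ^ 2) with hδ
    have osc : ∀ y ∈ Finset.Ico s (s + l), |p n (y - x) - p n (s - x)| ≤ δ := by
      intro y hy
      rw [Finset.mem_Ico] at hy
      obtain ⟨i, hi⟩ := Int.eq_ofNat_of_zero_le (sub_nonneg.mpr hy.1)
      have hil : i ≤ l := by omega
      have := abs_sub_le_of_increments (hA n) hl (hEmem x hx) hil
      rw [show y - x = s - x + i by omega]
      refine this.trans ?_
      rw [hδ]
      gcongr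
    have b1 : ∑ y ∈ Finset.Ico s (s + l), p n (y - x) * F y ≤ (p n (s - x) + δ) * S := by
      rw [hSdef, Finset.mul_sum]
      refine Finset.sum_le_sum fun y hy => mul_le_mul_of_nonneg_right ?_ (hF y)
      linarith [(abs_le.mp (osc y hy)).2]
    have b2 : l * (p n (s - x) - δ) ≤ ∑ y ∈ Finset.Ico s (s + l), p n (y - x) := by
      have := Finset.card_nsmul_le_sum (Finset.Ico s (s + l)) (fun y => p n (y - x))
        (p n (s - x) - δ) (fun y hy => by linarith [(abs_le.mp (osc y hy)).1])
      simpa using this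
    have hR : 0 ≤ ∑ y ∈ Finset.Ico s (s + l), p n (y - x) := Finset.sum_nonneg fun y _ => hp _ _
    set R := ∑ y ∈ Finset.Ico s (s + l), p n (y - x)
    have b3 : S * (p n (s - x) - δ) ≤ 2 * lam * R := by
      rcases le_or_gt (p n (s - x) - δ) 0 with hneg | hpos
      · exact (mul_nonpos_of_nonneg_of_nonpos hS hneg).trans (by positivity)
      · calc S * (p n (s - x) - δ) ≤ 2 * lam * l * (p n (s - x) - δ) := by gcongr
          _ = 2 * lam * (l * (p n (s - x) - δ)) := by ring
          _ ≤ _ := by gcongr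
    linarith

/-- Calderón–Zygmund decomposition on a dyadic interval, phrased for the maximal function of
the kernels `p n`. -/
lemma hasMajorant_dyadic {p : ℕ → ℤ → ℝ} {A : ℝ}
    (hA : ∀ (n : ℕ) (x : ℤ), (x : ℝ) ^ 2 * |p n (x + 1) - p n x| ≤ A)
    (hp : ∀ n x, 0 ≤ p n x) {lam : ℝ} (hlam : 0 < lam) {F : ℤ → ℝ} (hF : ∀ y, 0 ≤ F y)
    (j : ℕ) (s : ℤ) (hs : ∑ y ∈ Finset.Ico s (s + (2 ^ j : ℕ)), F y ≤ lam * (2 ^ j : ℕ)) :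
    HasMajorant p A lam F (Finset.Ico s (s + (2 ^ j : ℕ))) := by
  have hA0 : 0 ≤ A := by simpa using hA 0 0
  induction j generalizing s with
  | zero =>
    have e : Finset.Ico s (s + (2 ^ 0 : ℕ)) = {s} := by
      ext y
      simp only [Finset.mem_Ico, Finset.mem_singleton]
      omega
    rw [e] at hs ⊢
    simp only [HasMajorant, Finset.sum_singleton] at hs ⊢
    have hFs := hF s
    refine ⟨∅, fun _ => 0, by simpa using hFs, fun _ => le_rfl, fun W => ?_, fun x _ n => ?_⟩
    · rw [Finset.sum_const_zero]
      positivity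
    · have := hp n (s - x)
      simp only [pow_zero, Nat.cast_one, mul_one] at hs
      nlinarith [mul_nonneg this hlam.le]
  | succ j ih =>
    have hd := Finset.Ico_disjoint_Ico_consecutive s (s + (2 ^ j : ℕ))
      (s + (2 ^ j : ℕ) + (2 ^ j : ℕ))
    have e : Finset.Ico s (s + (2 ^ (j + 1) : ℕ)) = Finset.Ico s (s + (2 ^ j : ℕ)) ∪
        Finset.Ico (s + (2 ^ j : ℕ)) (s + (2 ^ j : ℕ) + (2 ^ j : ℕ)) := by
      rw [Finset.Ico_union_Ico_eq_Ico (le_add_of_nonneg_right (by positivity))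
        (le_add_of_nonneg_right (by positivity))]
      congr 1
      push_cast
      ring
    have hpow : ((2 ^ (j + 1) : ℕ) : ℝ) = 2 * (2 ^ j : ℕ) := by
      push_cast
      ring
    have hsum : ∀ s' : ℤ, 0 ≤ ∑ y ∈ Finset.Ico s' (s' + (2 ^ j : ℕ)), F y := fun s' =>
      Finset.sum_nonneg fun y _ => hF y
    have main : ∀ s' : ℤ, ∑ y ∈ Finset.Ico s' (s' + (2 ^ j : ℕ)), F y ≤ 2 * lam * (2 ^ j : ℕ) →
        HasMajorant p A lam F (Finset.Ico s' (s' + (2 ^ j : ℕ))) := by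
      intro s' hs'
      rcases le_total (∑ y ∈ Finset.Ico s' (s' + (2 ^ j : ℕ)), F y) (lam * (2 ^ j : ℕ)) with h | h
      · exact ih s' h
      · exact hasMajorant_of_average hA hp hF (by positivity) s' h hs'
    rw [e, hpow, Finset.sum_union hd] at hs
    rw [e]
    exact (main s (by linarith [hsum (s + (2 ^ j : ℕ))])).union hlam hd
      (main (s + (2 ^ j : ℕ)) (by linarith [hsum s]))

/-- Weak type `(1,1)` on `ℤ` for the maximal function of probability kernels `p n` whose
increments decay quadratically, uniformly in `n`. -/
lemma weak_type_int {p : ℕ → ℤ → ℝ} {A : ℝ}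
    (hA : ∀ (n : ℕ) (x : ℤ), (x : ℝ) ^ 2 * |p n (x + 1) - p n x| ≤ A)
    (hp : ∀ n, IsProbMeasure (p n)) {lam : ℝ} (hlam : 0 < lam) {F : ℤ → ℝ} (hF : ∀ y, 0 ≤ F y)
    (V W : Finset ℤ) (hW : ∀ x ∈ W, ∃ n, lam < ∑ y ∈ V, p n (y - x) * F y) :
    lam * W.card ≤ (12 + 48 * A) * ∑ y ∈ V, F y := by
  set S := ∑ y ∈ V, F y with hS
  obtain ⟨s, N, hV⟩ : ∃ (s : ℤ) (N : ℕ), V ⊆ Finset.Ico s (s + N) := by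
    obtain ⟨a, ha⟩ := V.bddBelow
    obtain ⟨b, hb⟩ := V.bddAbove
    refine ⟨a, (b - a + 1).toNat, fun y hy => Finset.mem_Ico.mpr ⟨ha hy, ?_⟩⟩
    have := hb hy
    omega
  set J := max N ⌈3 * S / lam⌉₊ with hJ
  have hJ1 : N ≤ 2 ^ J := (le_max_left _ _).trans Nat.lt_two_pow_self.le
  have hJ2 : S ≤ lam / 3 * (2 ^ J : ℕ) := by
    have h1 : ⌈3 * S / lam⌉₊ ≤ 2 ^ J := (le_max_right _ _).trans Nat.lt_two_pow_self.le
    have h2 : 3 * S / lam ≤ (2 ^ J : ℕ) := (Nat.le_ceil _).trans (by exact_mod_cast h1)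
    rw [div_le_iff₀ hlam] at h2
    linarith
  have hVJ : V ⊆ Finset.Ico s (s + (2 ^ J : ℕ)) :=
    hV.trans (Finset.Ico_subset_Ico_right (by
      have : (N : ℤ) ≤ (2 ^ J : ℕ) := by exact_mod_cast hJ1
      omega))
  have hG : ∀ y, 0 ≤ if y ∈ V then F y else 0 := fun y => by
    split_ifs
    exacts [hF y, le_rfl]
  have hsum : ∀ c : ℤ → ℝ, ∑ y ∈ Finset.Ico s (s + (2 ^ J : ℕ)), c y * (if y ∈ V then F y else 0)
      = ∑ y ∈ V, c y * F y := fun c => by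
    simp only [mul_ite, mul_zero]
    rw [← Finset.sum_filter, Finset.filter_mem_eq_inter, Finset.inter_eq_right.mpr hVJ]
  have hsum1 : ∑ y ∈ Finset.Ico s (s + (2 ^ J : ℕ)), (if y ∈ V then F y else 0) = S := by
    simpa using hsum fun _ => 1
  obtain ⟨E, h, h1, h2, h3, h4⟩ := hasMajorant_dyadic hA (fun n => (hp n).1)
    (lam := lam / 3) (by positivity) hG J s (by rw [hsum1]; exact hJ2)
  rw [hsum1] at h1
  simp only [hsum1] at h3
  have big : ∀ x ∈ W \ E, lam / 3 ≤ h x := by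
    intro x hx
    obtain ⟨hxW, hxE⟩ := Finset.mem_sdiff.mp hx
    obtain ⟨n, hn⟩ := hW x hxW
    have := h4 x hxE n
    rw [hsum fun y => p n (y - x)] at this
    have hle : ∑ y ∈ Finset.Ico s (s + (2 ^ J : ℕ)), p n (y - x) ≤ 1 :=
      sum_le_hasSum _ (fun y _ => (hp n).1 _)
        ((Equiv.subRight x).hasSum_iff.mpr (hp n).2)
    nlinarith
  have hWE : (W.card : ℝ) ≤ E.card + (W \ E).card := by
    have : W.card ≤ E.card + (W \ E).card := by
      rw [add_comm, ← Finset.card_union_of_disjoint Finset.sdiff_disjoint,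
        Finset.sdiff_union_self_eq_union]
      exact Finset.card_le_card Finset.subset_union_left
    exact_mod_cast this
  have hcount : (W \ E).card * (lam / 3) ≤ 16 * A * S := by
    have := Finset.card_nsmul_le_sum (W \ E) h _ big
    rw [nsmul_eq_mul] at this
    exact this.trans (h3 _)
  nlinarith

lemma measurePreserving_zpow {X : Type*} [MeasurableSpace X] {m : Measure X} {τ : Equiv.Perm X}
    (hsymm : Measurable (τ.symm : X → X)) (hτ : MeasurePreserving (τ : X → X) m m) (k : ℤ) :
    MeasurePreserving ((τ ^ k : Equiv.Perm X) : X → X) m m := by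
  have hinv : MeasurePreserving ((τ⁻¹ : Equiv.Perm X) : X → X) m m :=
    MeasurePreserving.symm ⟨τ, hτ.measurable, hsymm⟩ hτ
  obtain ⟨n, rfl | rfl⟩ := k.eq_nat_or_neg
  · rw [zpow_natCast, Equiv.Perm.coe_pow]
    exact hτ.iterate n
  · rw [zpow_neg, zpow_natCast, ← inv_pow, Equiv.Perm.coe_pow]
    exact hinv.iterate n

lemma le_of_forall_nat_mul_le {a b M : ℝ} (h : ∀ L : ℕ, L * a ≤ b * (L + M)) : a ≤ b := by
  by_contra! hab
  obtain ⟨L, hL⟩ := exists_nat_gt (b * M / (a - b))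
  rw [div_lt_iff₀ (sub_pos.mpr hab)] at hL
  linarith [h L]

/-- Calderón's transference of the weak type inequality from `ℤ` to a measure-preserving system,
for the kernels truncated to `[-R, R]`. -/
lemma weak_type_truncated {p : ℕ → ℤ → ℝ} {A : ℝ}
    (hA : ∀ (n : ℕ) (x : ℤ), (x : ℝ) ^ 2 * |p n (x + 1) - p n x| ≤ A)
    (hp : ∀ n, IsProbMeasure (p n)) {X : Type*} [MeasurableSpace X] {m : Measure X}
    [IsProbabilityMeasure m] {τ : Equiv.Perm X} (hsymm : Measurable (τ.symm : X → X))
    (hτ : MeasurePreserving (τ : X → X) m m) {G : X → ℝ} (hGm : Measurable G)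
    (hGi : Integrable G m) (hG : ∀ x, 0 ≤ G x) {lam : ℝ} (hlam : 0 < lam) (R : ℕ) :
    m.real {x | ∃ n : ℕ, lam < ∑ k ∈ Finset.Icc (-R : ℤ) R, p n k * G ((τ ^ k) x)}
      ≤ (12 + 48 * A) / lam * ∫ x, G x ∂m := by
  classical
  have hmp := measurePreserving_zpow hsymm hτ
  set S := {x | ∃ n : ℕ, lam < ∑ k ∈ Finset.Icc (-R : ℤ) R, p n k * G ((τ ^ k) x)} with hSdef
  have hS : MeasurableSet S := by
    rw [hSdef, Set.ofPred_exists]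
    refine MeasurableSet.iUnion fun n => measurableSet_lt measurable_const ?_
    exact Finset.measurable_sum _ fun k _ => (hGm.comp (hmp k).measurable).const_mul _
  refine le_of_forall_nat_mul_le (M := 2 * R + 1) fun L => ?_
  have hGk : ∀ k : ℤ, Integrable (fun x => G ((τ ^ k) x)) m := fun k =>
    (hmp k).integrable_comp_of_integrable hGi
  have hGint : ∀ k : ℤ, ∫ x, G ((τ ^ k) x) ∂m = ∫ x, G x ∂m := fun k => by
    have h := integral_map (μ := m) (hmp k).measurable.aemeasurable (f := G) hGm.aestronglyMeasurable
    rw [(hmp k).map_eq] at h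
    exact h.symm
  have hpre : ∀ k : ℤ, MeasurableSet (((τ ^ k : Equiv.Perm X) : X → X) ⁻¹' S) := fun k =>
    (hmp k).measurable hS
  have hleft : L * m.real S = ∫ x, ∑ j ∈ Finset.Ico (0 : ℤ) L,
      (((τ ^ j : Equiv.Perm X) : X → X) ⁻¹' S).indicator (fun _ => (1 : ℝ)) x ∂m := by
    rw [integral_finsetSum _ fun j _ => (integrable_const (1 : ℝ)).indicator (hpre j)]
    have : ∀ j : ℤ, ∫ x, (((τ ^ j : Equiv.Perm X) : X → X) ⁻¹' S).indicator
        (fun _ => (1 : ℝ)) x ∂m = m.real S := fun j => by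
      rw [integral_indicator_const _ (hpre j), smul_eq_mul, mul_one, measureReal_def,
        (hmp j).measure_preimage hS.nullMeasurableSet, measureReal_def]
    simp [this]
  have hright : (12 + 48 * A) / lam * (∫ x, G x ∂m) * (L + (2 * R + 1)) =
      ∫ x, (12 + 48 * A) / lam * ∑ y ∈ Finset.Ico (-R : ℤ) (L + R + 1), G ((τ ^ y) x) ∂m := by
    rw [integral_const_mul, integral_finsetSum _ fun y _ => hGk y]
    simp only [hGint, Finset.sum_const, Int.card_Ico, nsmul_eq_mul]
    rw [show ((L : ℤ) + R + 1 - -R).toNat = L + (2 * R + 1) by omega]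
    push_cast
    ring
  rw [hleft, hright]
  refine integral_mono
    (integrable_finsetSum _ fun j _ => (integrable_const (1 : ℝ)).indicator (hpre j))
    ((integrable_finsetSum _ fun y _ => hGk y).const_mul _) fun x => ?_
  have key := weak_type_int hA hp hlam (F := fun y => G ((τ ^ y) x)) (fun y => hG _)
    (Finset.Ico (-R : ℤ) (L + R + 1)) {j ∈ Finset.Ico (0 : ℤ) L | (τ ^ j) x ∈ S} (by
      intro j hj
      obtain ⟨hj1, n, hn⟩ := Finset.mem_filter.mp hj
      rw [Finset.mem_Ico] at hj1
      refine ⟨n, hn.trans_le ?_⟩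
      have e : ∑ k ∈ Finset.Icc (-R : ℤ) R, p n k * G ((τ ^ k) ((τ ^ j) x)) =
          ∑ y ∈ (Finset.Icc (-R : ℤ) R).map (Equiv.addRight j).toEmbedding,
            p n (y - j) * G ((τ ^ y) x) := by
        rw [Finset.sum_map]
        refine Finset.sum_congr rfl fun k _ => ?_
        simp [zpow_add]
      rw [e]
      refine Finset.sum_le_sum_of_subset_of_nonneg (fun y hy => ?_)
        fun y _ _ => mul_nonneg ((hp n).1 _) (hG _)
      obtain ⟨k, hk, rfl⟩ := Finset.mem_map.mp hy
      rw [Finset.mem_Icc] at hk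
      simp only [Equiv.coe_toEmbedding, Equiv.coe_addRight, Finset.mem_Ico]
      omega)
  have hcard : ∑ j ∈ Finset.Ico (0 : ℤ) L,
      (((τ ^ j : Equiv.Perm X) : X → X) ⁻¹' S).indicator (fun _ => (1 : ℝ)) x =
      ({j ∈ Finset.Ico (0 : ℤ) L | (τ ^ j) x ∈ S} : Finset ℤ).card := by
    simp only [Set.indicator_apply, Set.mem_preimage]
    rw [Finset.sum_boole]
  dsimp only
  rw [hcard, div_mul_eq_mul_div, le_div_iff₀ hlam, mul_comm]
  exact key

/-- If `|∑ a k|` exceeds `lam ≥ 0` then so does a symmetric partial sum of `∑ |a k|`. -/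
lemma exists_lt_sum_Icc_of_lt_abs_tsum {a : ℤ → ℝ} {lam : ℝ} (hlam : 0 ≤ lam)
    (h : lam < |∑' k, a k|) : ∃ R : ℕ, lam < ∑ k ∈ Finset.Icc (-R : ℤ) R, |a k| := by
  have ha : Summable a := by
    by_contra hn
    rw [tsum_eq_zero_of_not_summable hn, abs_zero] at h
    exact absurd h hlam.not_gt
  have h' : lam < ∑' k, |a k| := h.trans_le (norm_tsum_le_tsum_norm ha.norm)
  obtain ⟨V, hV⟩ := ((tendsto_order.mp ha.abs.hasSum).1 _ h').exists
  refine ⟨V.sup Int.natAbs, hV.trans_le ?_⟩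
  refine Finset.sum_le_sum_of_subset_of_nonneg (fun k hk => ?_) fun k _ _ => abs_nonneg _
  have := Finset.le_sup (f := Int.natAbs) hk
  rw [Finset.mem_Icc]
  omega

/-- Weak type `(1,1)` for the maximal function of probability kernels `p n` on `ℤ` whose
increments decay quadratically, uniformly in `n`, acting along a measure-preserving system. -/
lemma weak_type_of_increments {p : ℕ → ℤ → ℝ} {A : ℝ}
    (hA : ∀ (n : ℕ) (x : ℤ), (x : ℝ) ^ 2 * |p n (x + 1) - p n x| ≤ A)
    (hp : ∀ n, IsProbMeasure (p n)) {X : Type*} [MeasurableSpace X] {m : Measure X}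
    [IsProbabilityMeasure m] {τ : Equiv.Perm X} (hsymm : Measurable (τ.symm : X → X))
    (hτ : MeasurePreserving (τ : X → X) m m) {f : X → ℝ} (hf : Integrable f m)
    {lam : ℝ} (hlam : 0 < lam) :
    m {x : X | ∃ n : ℕ, lam < |∑' k : ℤ, p n k * f ((τ ^ k) x)|}
      ≤ ENNReal.ofReal ((12 + 48 * A) / lam * ∫ x, |f x| ∂m) := by
  set g := hf.1.mk f
  have hfg : f =ᵐ[m] g := hf.1.ae_eq_mk
  have hgm : Measurable g := hf.1.stronglyMeasurable_mk.measurable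
  have hgi : Integrable g m := hf.congr hfg
  have hmp := measurePreserving_zpow hsymm hτ
  have hae : ∀ᵐ x ∂m, ∀ k : ℤ, f ((τ ^ k) x) = g ((τ ^ k) x) :=
    ae_all_iff.mpr fun k => (hmp k).quasiMeasurePreserving.ae hfg
  set S : ℕ → Set X := fun R =>
    {x | ∃ n : ℕ, lam < ∑ k ∈ Finset.Icc (-R : ℤ) R, p n k * |g ((τ ^ k) x)|}
  have hmono : Monotone S := by
    rintro R R' hR x ⟨n, hn⟩
    refine ⟨n, hn.trans_le (Finset.sum_le_sum_of_subset_of_nonneg ?_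
      fun k _ _ => mul_nonneg ((hp n).1 k) (abs_nonneg _))⟩
    exact Finset.Icc_subset_Icc (by omega) (by omega)
  calc _ ≤ m (⋃ R, S R) := by
        refine measure_mono_ae ?_
        filter_upwards [hae] with x hx
        rintro ⟨n, hn⟩
        obtain ⟨R, hR⟩ := exists_lt_sum_Icc_of_lt_abs_tsum hlam.le hn
        refine Set.mem_iUnion.mpr ⟨R, n, ?_⟩
        simpa only [abs_mul, abs_of_nonneg ((hp n).1 _), hx] using hR
    _ = ⨆ R, m (S R) := hmono.measure_iUnion
    _ ≤ _ := iSup_le fun R => by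
        have := weak_type_truncated hA hp hsymm hτ hgm.abs hgi.abs (fun x => abs_nonneg _) hlam R
        rw [show ∫ x, |f x| ∂m = ∫ x, |g x| ∂m from
          integral_congr_ae (hfg.mono fun x hx => by simp only [hx])]
        rw [← ofReal_measureReal]
        exact ENNReal.ofReal_le_ofReal this

/-- under the hypotheses of Theorem 2.1.3 on the sequence `ν`, the maximal
operator `Mf(x) = sup_n |μ_n f(x)|`, for `μ_n = ν_0 ∗ ⋯ ∗ ν_n`, is of weak type `(1,1)`:
there is a constant `C' > 0` such that for every invertible measure-preserving `τ` of a
probability space, every `f ∈ L¹` and every `λ > 0`,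
`m {x : Mf(x) > λ} ≤ (C'/λ) ‖f‖₁`. -/
theorem maximal_weak_type_one_one
    (ν : ℕ → ℤ → ℝ)
    (hprob : ∀ n, IsProbMeasure (ν n))
    (hap : ∀ n, StrictlyAperiodic (ν n))
    (hE : ∀ n, expectation (ν n) = 0)
    (hm2 : ∀ n, Summable fun k : ℤ => |(k : ℝ)| ^ 2 * ν n k)
    (hφ : ∃ K : ℝ, ∀ n : ℕ, ∑ i ∈ Finset.range (n + 1), m2 (ν i) ≤ K * (n + 1))
    (C : ℝ) (hC : 0 < C) (N₀ : ℕ)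
    (hft : ∀ n > N₀, ∀ t ∈ Set.Ico (-(1 : ℝ) / 2) (1 / 2),
      ‖ft (ν n) t‖ ≤ Real.exp (-C * t ^ 2)) :
    ∃ C' : ℝ, 0 < C' ∧
      ∀ (X : Type) [MeasurableSpace X] (m : Measure X), IsProbabilityMeasure m →
        ∀ τ : Equiv.Perm X, Measurable (τ : X → X) → Measurable (τ.symm : X → X) →
          MeasurePreserving (τ : X → X) m m →
          ∀ f : X → ℝ, Integrable f m → ∀ lam : ℝ, 0 < lam →
            m {x : X | ∃ n : ℕ, lam < |∑' k : ℤ, muN ν n k * f ((τ ^ k) x)|}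
              ≤ ENNReal.ofReal (C' / lam * ∫ x, |f x| ∂m) := by
  obtain ⟨A, hA⟩ := exists_sq_mul_abs_sub_le hprob hE hm2 hφ hC hft
  have hA0 : 0 ≤ A := by simpa using hA 0 0
  refine ⟨12 + 48 * A, by positivity, fun X _ m _ τ _ hsymm hτ f hf lam hlam => ?_⟩
  exact weak_type_of_increments hA (isProbMeasure_muN hprob) hsymm hτ hf hlam
end

section
/- Let (ν_n) be a sequence of strictly aperiodic probability measures on ℤ such that E(ν_n) = 0 for all n, such that φ(n) = ∑_{i=1}^n m₂(ν_i) = O(n), and such that there exist a constant C > 0 and an integer N₀ > 0 with |ν̂_n(t)| ≤ e^{−Ct²} for all n > N₀ and all t ∈ [−1/2, 1/2). Set μ_n = ν_1∗⋯∗ν_n. Then for every invertible measure-preserving transformation τ of a probability space (X, B, m) and every f ∈ L¹(X), the sequence μ_n f(x) = ∑_{k∈ℤ} μ_n(k) f(τ^k x) converges for almost every x ∈ X. -/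
open scoped BigOperators
open Filter MeasureTheory

namespace ConvAverages

/-- The character `k ↦ e^{2πikt}` of `ℤ`. -/
noncomputable def chr (t : ℝ) (k : ℤ) : ℂ :=
  Complex.exp (2 * Real.pi * Complex.I * (k : ℂ) * (t : ℂ))

lemma chr_eq (t : ℝ) (k : ℤ) : chr t k = Complex.exp ((2 * Real.pi * k * t : ℝ) * Complex.I) := by
  unfold chr; congr 1; push_cast; ring

lemma norm_chr (t : ℝ) (k : ℤ) : ‖chr t k‖ = 1 := by
  rw [chr_eq, Complex.norm_exp_ofReal_mul_I]

lemma chr_add (t : ℝ) (k l : ℤ) : chr t (k + l) = chr t k * chr t l := by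
  unfold chr; rw [← Complex.exp_add]; congr 1; push_cast; ring

lemma norm_chr_sub_one_le (t : ℝ) (k : ℤ) : ‖chr t k - 1‖ ≤ 2 * Real.pi * |(k : ℝ)| * |t| := by
  rw [chr_eq, mul_comm _ Complex.I]
  refine (Real.norm_exp_I_mul_ofReal_sub_one_le).trans (le_of_eq ?_)
  rw [Real.norm_eq_abs, abs_mul, abs_mul, abs_of_pos Real.two_pi_pos]

lemma ft_eq (a : ℤ → ℝ) (t : ℝ) : ft a t = ∑' k, (a k : ℂ) * chr t k := rfl

lemma summable_norm_mul_chr {a : ℤ → ℝ} (ha : Summable a) (t : ℝ) :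
    Summable fun k => ‖(a k : ℂ) * chr t k‖ := by
  simpa [norm_chr] using ha.abs

lemma hasSum_ft {a : ℤ → ℝ} (ha : Summable a) (t : ℝ) :
    HasSum (fun k => (a k : ℂ) * chr t k) (ft a t) :=
  (summable_norm_mul_chr ha t).of_norm.hasSum

lemma ft_add {a b : ℤ → ℝ} (ha : Summable a) (hb : Summable b) (t : ℝ) :
    ft (fun k => a k + b k) t = ft a t + ft b t := by
  refine HasSum.tsum_eq ?_
  convert (hasSum_ft ha t).add (hasSum_ft hb t) using 2 with k
  simp only [chr]; push_cast; ring

lemma norm_ft_le {a : ℤ → ℝ} (ha : Summable a) (t : ℝ) : ‖ft a t‖ ≤ ∑' k, |a k| := by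
  rw [ft_eq]
  refine (norm_tsum_le_tsum_norm (summable_norm_mul_chr ha t)).trans (le_of_eq ?_)
  simp [norm_chr]

/-- The shear `(k, j) ↦ (k - j, j)` of `ℤ × ℤ`. -/
def shear : ℤ × ℤ ≃ ℤ × ℤ where
  toFun p := (p.1 - p.2, p.2)
  invFun p := (p.1 + p.2, p.2)
  left_inv p := by simp
  right_inv p := by simp

lemma summable_conv_prod {a b : ℤ → ℝ} (ha : Summable a) (hb : Summable b) :
    Summable fun p : ℤ × ℤ => a (p.1 - p.2) * b p.2 :=
  shear.summable_iff.2 (summable_mul_of_summable_norm ha.norm hb.norm)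

lemma hasSum_conv {a b : ℤ → ℝ} (ha : Summable a) (hb : Summable b) (k : ℤ) :
    HasSum (fun j => a (k - j) * b j) (conv a b k) :=
  ((summable_conv_prod ha hb).prod_factor k).hasSum

lemma conv_summable {a b : ℤ → ℝ} (ha : Summable a) (hb : Summable b) : Summable (conv a b) :=
  (summable_conv_prod ha hb).prod

lemma tsum_shear {f : ℤ × ℤ → ℂ} (hf : Summable f) :
    ∑' p, f p = ∑' k, ∑' j, f (k - j, j) := by
  rw [← shear.tsum_eq]
  exact (shear.summable_iff.2 hf).tsum_prod

lemma ft_conv {a b : ℤ → ℝ} (ha : Summable a) (hb : Summable b) (t : ℝ) :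
    ft (conv a b) t = ft a t * ft b t := by
  have hA := summable_norm_mul_chr ha t
  have hB := summable_norm_mul_chr hb t
  rw [ft_eq a, ft_eq b, tsum_mul_tsum_of_summable_norm hA hB,
    tsum_shear (summable_mul_of_summable_norm hA hB), ft_eq]
  refine tsum_congr fun k => ?_
  have h := ((Complex.hasSum_ofReal.2 (hasSum_conv ha hb k)).mul_right (chr t k)).tsum_eq
  rw [← h]
  refine tsum_congr fun j => ?_
  have : chr t k = chr t (k - j) * chr t j := by rw [← chr_add]; simp
  simp only [this]
  push_cast; ring

lemma tsum_eq_ft_zero (a : ℤ → ℝ) : ((∑' k, a k : ℝ) : ℂ) = ft a 0 := by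
  simp [ft, Complex.ofReal_tsum]

lemma tsum_conv {a b : ℤ → ℝ} (ha : Summable a) (hb : Summable b) :
    ∑' k, conv a b k = (∑' k, a k) * ∑' k, b k := by
  apply Complex.ofReal_injective
  rw [Complex.ofReal_mul, tsum_eq_ft_zero, tsum_eq_ft_zero, tsum_eq_ft_zero, ft_conv ha hb]

/-- Multiplication by the identity function of `ℤ`. -/
def dil (a : ℤ → ℝ) (k : ℤ) : ℝ := k * a k

lemma dil_conv {a b : ℤ → ℝ} (ha : Summable a) (hb : Summable b) (ha' : Summable (dil a))
    (hb' : Summable (dil b)) :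
    dil (conv a b) = fun k => conv (dil a) b k + conv a (dil b) k := by
  funext k
  refine ((hasSum_conv ha hb k).mul_left (k : ℝ)).unique ?_
  refine ((hasSum_conv ha' hb k).add (hasSum_conv ha hb' k)).congr_fun fun j => ?_
  simp only [dil]; push_cast; ring

lemma summable_dil {a : ℤ → ℝ} (h : Summable (dil (dil a))) : Summable (dil a) := by
  refine Summable.of_norm_bounded h.norm fun k => ?_
  simp only [dil, norm_mul]
  rcases eq_or_ne k 0 with rfl | hk
  · simp
  · have : (1 : ℝ) ≤ ‖(k : ℝ)‖ := by
      rw [Real.norm_eq_abs]; exact_mod_cast Int.one_le_abs hk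
    exact le_mul_of_one_le_left (by positivity) this

lemma dil_dil_conv {a b : ℤ → ℝ} (ha : Summable a) (hb : Summable b)
    (ha' : Summable (dil (dil a))) (hb' : Summable (dil (dil b))) :
    dil (dil (conv a b)) = fun k => (conv (dil (dil a)) b k + conv (dil a) (dil b) k) +
      (conv (dil a) (dil b) k + conv a (dil (dil b)) k) := by
  have h1 := dil_conv (summable_dil ha') hb ha' (summable_dil hb')
  have h2 := dil_conv ha (summable_dil hb') (summable_dil ha') hb'
  rw [dil_conv ha hb (summable_dil ha') (summable_dil hb')]
  funext k
  have e1 : (k : ℝ) * conv (dil a) b k = _ := congrFun h1 k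
  have e2 : (k : ℝ) * conv a (dil b) k = _ := congrFun h2 k
  rw [← e1, ← e2, ← mul_add]
  rfl

lemma integral_chr (m : ℤ) :
    ∫ t in Set.Ioc (-(1 : ℝ) / 2) (1 / 2), chr t m = if m = 0 then 1 else 0 := by
  rw [← intervalIntegral.integral_of_le (by norm_num)]
  split_ifs with h
  · subst h; simp [chr]; norm_num
  · have hc : (2 * Real.pi * Complex.I * (m : ℂ)) ≠ 0 := by
      simp [Real.pi_ne_zero, h]
    have : (fun t : ℝ => chr t m) = fun t : ℝ => Complex.exp (2 * Real.pi * Complex.I * m * t) := rfl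
    rw [this, integral_exp_mul_complex hc, div_eq_zero_iff]
    left
    rw [sub_eq_zero, Complex.exp_eq_exp_iff_exists_int]
    exact ⟨m, by push_cast; ring⟩

lemma coeff_eq_integral {a : ℤ → ℝ} (ha : Summable a) (k : ℤ) :
    (a k : ℂ) = ∫ t in Set.Ioc (-(1 : ℝ) / 2) (1 / 2), ft a t * chr t (-k) := by
  have hcont : ∀ m, Continuous fun t => chr t m := fun m => by unfold chr; fun_prop
  have hvol : (volume.restrict (Set.Ioc (-(1 : ℝ) / 2) (1 / 2))).real Set.univ = 1 := by
    rw [Measure.real, Measure.restrict_apply_univ, Real.volume_Ioc]; norm_num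
  have h := hasSum_integral_of_summable_integral_norm
    (μ := volume.restrict (Set.Ioc (-(1 : ℝ) / 2) (1 / 2)))
    (F := fun j t => (a j : ℂ) * chr t j * chr t (-k)) ?_ ?_
  · have h2 : (fun t => ∑' j, (a j : ℂ) * chr t j * chr t (-k)) = fun t => ft a t * chr t (-k) := by
      funext t
      exact ((hasSum_ft ha t).mul_right _).tsum_eq
    rw [h2] at h
    refine HasSum.unique ?_ h
    refine (hasSum_ite_eq k (a k : ℂ)).congr_fun fun j => ?_
    simp_rw [mul_assoc, ← chr_add]
    rw [integral_const_mul, integral_chr]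
    by_cases hj : j = k
    · subst hj; simp
    · have : j + -k ≠ 0 := by omega
      simp [hj, this]
  · intro j
    refine Continuous.integrableOn_Ioc ?_
    exact (continuous_const.mul (hcont j)).mul (hcont (-k))
  · simp only [norm_mul, norm_chr, integral_const, hvol]
    simpa using ha.abs

lemma abs_coeff_le {a : ℤ → ℝ} (ha : Summable a) {Q β : ℝ} (hQ : 0 ≤ Q) (hβ : 0 < β)
    (h : ∀ t ∈ Set.Ico (-(1 : ℝ) / 2) (1 / 2), ‖ft a t‖ ≤ Q * Real.exp (-β * t ^ 2)) (k : ℤ) :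
    |a k| ≤ Q * √(Real.pi / β) := by
  have h1 : |a k| = ‖(a k : ℂ)‖ := by simp
  rw [h1, coeff_eq_integral ha k, ← integral_Ico_eq_integral_Ioc]
  have hg : Integrable fun t : ℝ => Q * Real.exp (-β * t ^ 2) :=
    (integrable_exp_neg_mul_sq hβ).const_mul Q
  refine (norm_integral_le_of_norm_le hg.integrableOn
    ((ae_restrict_mem measurableSet_Ico).mono fun t ht => ?_)).trans ?_
  · simpa [norm_chr] using h t ht
  · refine (setIntegral_le_integral hg (Eventually.of_forall fun t => by positivity)).trans ?_
    rw [integral_const_mul, integral_gaussian]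

lemma _root_.IsProbMeasure.summable {a : ℤ → ℝ} (ha : IsProbMeasure a) : Summable a := ha.2.summable

lemma dil_dil_eq (a : ℤ → ℝ) : dil (dil a) = fun k : ℤ => |(k : ℝ)| ^ 2 * a k := by
  funext k; simp only [dil, sq_abs]; ring

lemma m2_nonneg {a : ℤ → ℝ} (ha : IsProbMeasure a) : 0 ≤ m2 a :=
  tsum_nonneg fun k => mul_nonneg (by positivity) (ha.1 k)

lemma norm_ft_le_one {a : ℤ → ℝ} (ha : IsProbMeasure a) (t : ℝ) : ‖ft a t‖ ≤ 1 := by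
  refine (norm_ft_le ha.summable t).trans (le_of_eq ?_)
  simp_rw [abs_of_nonneg (ha.1 _)]
  exact ha.2.tsum_eq

lemma norm_ft_dil_dil_le {a : ℤ → ℝ} (ha : IsProbMeasure a) (h2 : Summable (dil (dil a)))
    (t : ℝ) : ‖ft (dil (dil a)) t‖ ≤ m2 a := by
  refine (norm_ft_le h2 t).trans (le_of_eq ?_)
  rw [dil_dil_eq]
  exact tsum_congr fun k => abs_of_nonneg (mul_nonneg (by positivity) (ha.1 k))

lemma norm_ft_dil_le {a : ℤ → ℝ} (ha : IsProbMeasure a) (h2 : Summable (dil (dil a)))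
    (hE : expectation a = 0) (t : ℝ) : ‖ft (dil a) t‖ ≤ 2 * Real.pi * m2 a * |t| := by
  have h0 : HasSum (fun k => (dil a k : ℂ)) ((0 : ℝ) : ℂ) := by
    rw [Complex.hasSum_ofReal, ← hE]
    exact (summable_dil h2).hasSum
  have h1 := (hasSum_ft (summable_dil h2) t).sub h0
  have h3 : HasSum (fun k : ℤ => 2 * Real.pi * |t| * (|(k : ℝ)| ^ 2 * a k))
      (2 * Real.pi * |t| * m2 a) := by
    refine HasSum.mul_left _ ?_
    rw [dil_dil_eq] at h2
    exact h2.hasSum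
  rw [Complex.ofReal_zero, sub_zero] at h1
  have h4 : ∀ k : ℤ, ‖(dil a k : ℂ) * chr t k - (dil a k : ℂ)‖ ≤
      2 * Real.pi * |t| * (|(k : ℝ)| ^ 2 * a k) := fun k => by
    have e : (dil a k : ℂ) * chr t k - (dil a k : ℂ) = (dil a k : ℂ) * (chr t k - 1) := by ring
    rw [e, norm_mul, Complex.norm_real, dil, norm_mul, Real.norm_eq_abs, Real.norm_eq_abs,
      abs_of_nonneg (ha.1 k)]
    calc |(k : ℝ)| * a k * ‖chr t k - 1‖
        ≤ |(k : ℝ)| * a k * (2 * Real.pi * |(k : ℝ)| * |t|) :=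
          mul_le_mul_of_nonneg_left (norm_chr_sub_one_le t k)
            (mul_nonneg (abs_nonneg _) (ha.1 k))
      _ = _ := by ring
  rw [← h1.tsum_eq]
  refine (tsum_of_norm_bounded h3 h4).trans (le_of_eq (by ring))

lemma conv_isProbMeasure {a b : ℤ → ℝ} (ha : IsProbMeasure a) (hb : IsProbMeasure b) :
    IsProbMeasure (conv a b) := by
  refine ⟨fun k => tsum_nonneg fun j => mul_nonneg (ha.1 _) (hb.1 _), ?_⟩
  have h := (conv_summable ha.summable hb.summable).hasSum
  rwa [tsum_conv ha.summable hb.summable, ha.2.tsum_eq, hb.2.tsum_eq, mul_one] at h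

lemma muN_isProbMeasure {ν : ℕ → ℤ → ℝ} (hprob : ∀ n, IsProbMeasure (ν n)) (n : ℕ) :
    IsProbMeasure (muN ν n) := by
  induction n with
  | zero => exact hprob 0
  | succ n ih => exact conv_isProbMeasure ih (hprob _)

lemma summable_dil_dil_muN {ν : ℕ → ℤ → ℝ} (hprob : ∀ n, IsProbMeasure (ν n))
    (h2 : ∀ n, Summable (dil (dil (ν n)))) (n : ℕ) : Summable (dil (dil (muN ν n))) := by
  induction n with
  | zero => exact h2 0
  | succ n ih =>
    have hs := (muN_isProbMeasure hprob n).summable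
    have hs' := (hprob (n + 1)).summable
    rw [muN, dil_dil_conv hs hs' ih (h2 _)]
    exact ((conv_summable ih hs').add (conv_summable (summable_dil ih) (summable_dil (h2 _)))).add
      ((conv_summable (summable_dil ih) (summable_dil (h2 _))).add (conv_summable hs (h2 _)))

/-- If `‖ν̂ᵢ(t)‖ ≤ bᵢ w`, the Fourier transforms of `μₙ`, `k μₙ(k)` and `k² μₙ(k)` at `t` are
controlled by `w`, `∏ bᵢ` and `∑ m₂(νᵢ)`. -/
lemma norm_ft_muN_le {ν : ℕ → ℤ → ℝ} (hprob : ∀ n, IsProbMeasure (ν n))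
    (h2 : ∀ n, Summable (dil (dil (ν n)))) (hE : ∀ n, expectation (ν n) = 0)
    {t w : ℝ} (hw0 : 0 ≤ w) (hw1 : w ≤ 1) {b : ℕ → ℝ} (hb : ∀ n, 1 ≤ b n)
    (hft : ∀ n, ‖ft (ν n) t‖ ≤ b n * w) (n : ℕ) :
    let P := ∏ i ∈ Finset.range (n + 1), b i
    let φ := ∑ i ∈ Finset.range (n + 1), m2 (ν i)
    ‖ft (muN ν n) t‖ ≤ P * w ^ (n + 1) ∧
    ‖ft (dil (muN ν n)) t‖ * w ≤ 2 * Real.pi * φ * |t| * (P * w ^ (n + 1)) ∧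
    ‖ft (dil (dil (muN ν n))) t‖ * w ^ 2 ≤
      (φ + (2 * Real.pi * φ * |t|) ^ 2) * (P * w ^ (n + 1)) := by
  have hpi := Real.pi_pos
  induction n with
  | zero =>
    have hm := m2_nonneg (hprob 0)
    have hbw : w ≤ b 0 * w := le_mul_of_one_le_left hw0 (hb 0)
    simp only [zero_add, Finset.range_one, Finset.prod_singleton, Finset.sum_singleton, pow_one,
      muN]
    refine ⟨hft 0, ?_, ?_⟩
    · exact mul_le_mul (norm_ft_dil_le (hprob 0) (h2 0) (hE 0) t) hbw hw0 (by positivity)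
    · refine mul_le_mul ?_ ?_ (by positivity) (by positivity)
      · exact (norm_ft_dil_dil_le (hprob 0) (h2 0) t).trans (le_add_of_nonneg_right (sq_nonneg _))
      · nlinarith
  | succ n ih =>
    obtain ⟨i0, i1, i2⟩ := ih
    have hs := (muN_isProbMeasure hprob n).summable
    have hs2 := summable_dil_dil_muN hprob h2 n
    have hs1 := summable_dil hs2
    have gs := (hprob (n + 1)).summable
    have gs2 := h2 (n + 1)
    have gs1 := summable_dil gs2
    have g0 := hft (n + 1)
    have g1 := norm_ft_dil_le (hprob (n + 1)) gs2 (hE (n + 1)) t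
    have g2 := norm_ft_dil_dil_le (hprob (n + 1)) gs2 t
    have hm := m2_nonneg (hprob (n + 1))
    have hφ : 0 ≤ ∑ i ∈ Finset.range (n + 1), m2 (ν i) :=
      Finset.sum_nonneg fun i _ => m2_nonneg (hprob i)
    have hP : 0 ≤ ∏ i ∈ Finset.range (n + 1), b i :=
      Finset.prod_nonneg fun i _ => zero_le_one.trans (hb i)
    have hb1 := hb (n + 1)
    simp only [muN]
    rw [Finset.sum_range_succ, Finset.prod_range_succ]
    rw [dil_dil_conv hs gs hs2 gs2, dil_conv hs gs hs1 gs1]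
    rw [ft_add ((conv_summable hs2 gs).add (conv_summable hs1 gs1))
        ((conv_summable hs1 gs1).add (conv_summable hs gs2)),
      ft_add (conv_summable hs2 gs) (conv_summable hs1 gs1),
      ft_add (conv_summable hs1 gs1) (conv_summable hs gs2),
      ft_add (conv_summable hs1 gs) (conv_summable hs gs1),
      ft_conv hs gs, ft_conv hs1 gs, ft_conv hs gs1, ft_conv hs2 gs, ft_conv hs1 gs1,
      ft_conv hs gs2]
    generalize ft (muN ν n) t = F0 at *
    generalize ft (dil (muN ν n)) t = F1 at *
    generalize ft (dil (dil (muN ν n))) t = F2 at *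
    generalize ft (ν (n + 1)) t = G0 at *
    generalize ft (dil (ν (n + 1))) t = G1 at *
    generalize ft (dil (dil (ν (n + 1)))) t = G2 at *
    generalize ∑ i ∈ Finset.range (n + 1), m2 (ν i) = φ at *
    generalize m2 (ν (n + 1)) = m at *
    generalize hβ : b (n + 1) = β at *
    have hR : 0 ≤ (∏ i ∈ Finset.range (n + 1), b i) * w ^ (n + 1) := by positivity
    have hQ : (∏ i ∈ Finset.range (n + 1), b i) * β * w ^ (n + 1 + 1) =
        ((∏ i ∈ Finset.range (n + 1), b i) * w ^ (n + 1)) * (β * w) := by ring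
    rw [hQ]
    generalize (∏ i ∈ Finset.range (n + 1), b i) * w ^ (n + 1) = R at *
    have hbw : w ≤ β * w := le_mul_of_one_le_left hw0 hb1
    have hww : w ^ 2 ≤ β * w := by nlinarith
    refine ⟨?_, ?_, ?_⟩
    · rw [norm_mul]
      exact mul_le_mul i0 g0 (norm_nonneg _) hR
    · calc ‖F1 * G0 + F0 * G1‖ * w ≤ (‖F1‖ * ‖G0‖ + ‖F0‖ * ‖G1‖) * w := by
            gcongr; exact (norm_add_le _ _).trans (by simp)
        _ = (‖F1‖ * w) * ‖G0‖ + ‖F0‖ * ‖G1‖ * w := by ring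
        _ ≤ (2 * Real.pi * φ * |t| * R) * (β * w) + R * (2 * Real.pi * m * |t|) * (β * w) := by
            gcongr
        _ = _ := by ring
    · calc ‖F2 * G0 + F1 * G1 + (F1 * G1 + F0 * G2)‖ * w ^ 2
          ≤ (‖F2‖ * ‖G0‖ + ‖F1‖ * ‖G1‖ + (‖F1‖ * ‖G1‖ + ‖F0‖ * ‖G2‖)) * w ^ 2 := by
            gcongr
            refine (norm_add_le _ _).trans (add_le_add ?_ ?_) <;>
            exact (norm_add_le _ _).trans (by simp)
        _ = (‖F2‖ * w ^ 2) * ‖G0‖ + 2 * ((‖F1‖ * w) * ‖G1‖ * w) + ‖F0‖ * ‖G2‖ * w ^ 2 := by ring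
        _ ≤ ((φ + (2 * Real.pi * φ * |t|) ^ 2) * R) * (β * w) +
            2 * ((2 * Real.pi * φ * |t| * R) * (2 * Real.pi * m * |t|) * (β * w)) +
            R * m * (β * w) := by
            gcongr
        _ ≤ ((φ + (2 * Real.pi * φ * |t|) ^ 2) * R) * (β * w) +
            2 * ((2 * Real.pi * φ * |t| * R) * (2 * Real.pi * m * |t|) * (β * w)) +
            R * m * (β * w) + (2 * Real.pi * m * |t|) ^ 2 * (R * (β * w)) :=
            le_add_of_nonneg_right (by positivity)
        _ = _ := by ring

lemma ft_succ_sub {a : ℤ → ℝ} (ha : Summable a) (t : ℝ) :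
    ft (fun k => a (k + 1) - a k) t = ft a t * (chr t (-1) - 1) := by
  have h1 : HasSum (fun k => (a (k + 1) : ℂ) * chr t (k + 1)) (ft a t) :=
    (Equiv.addRight (1 : ℤ)).hasSum_iff.2 (hasSum_ft ha t)
  rw [mul_sub, mul_one, ft_eq]
  refine (((h1.mul_right (chr t (-1))).sub (hasSum_ft ha t)).congr_fun fun k => ?_).tsum_eq
  have : chr t k = chr t (k + 1) * chr t (-1) := by rw [← chr_add]; simp
  rw [mul_assoc, ← this]
  push_cast; ring

lemma prod_ite_le_pow {E : ℝ} (hE : 1 ≤ E) (N₀ n : ℕ) :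
    ∏ i ∈ Finset.range n, (if i ≤ N₀ then E else 1) ≤ E ^ (N₀ + 1) := by
  rw [Finset.prod_ite, Finset.prod_const_one, mul_one, Finset.prod_const]
  refine pow_le_pow_right₀ hE ?_
  calc _ ≤ (Finset.range (N₀ + 1)).card := Finset.card_le_card fun i hi => by
        simp only [Finset.mem_filter, Finset.mem_range] at hi ⊢; omega
    _ = _ := Finset.card_range _

lemma mul_exp_neg_le {C s : ℝ} (hC : 0 < C) : s * Real.exp (-C * s) ≤
    2 / C * Real.exp (-(C / 2) * s) := by
  have h : C * s / 2 ≤ Real.exp (C * s / 2) := by linarith [Real.add_one_le_exp (C * s / 2)]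
  have e : Real.exp (-(C / 2) * s) = Real.exp (C * s / 2) * Real.exp (-C * s) := by
    rw [← Real.exp_add]; congr 1; ring
  rw [e, ← mul_assoc]
  refine mul_le_mul_of_nonneg_right ?_ (Real.exp_pos _).le
  calc s = 2 / C * (C * s / 2) := by field_simp
    _ ≤ _ := by gcongr

lemma exp_neg_le {C s : ℝ} (hC : 0 < C) (hs : 0 ≤ s) :
    Real.exp (-C * s) ≤ Real.exp (-(C / 2) * s) := by
  rw [Real.exp_le_exp]; nlinarith [mul_nonneg hC.le hs]

/-- If the Fourier transform of `a` is at most `Q e^{-C N t² / 2}`, then `a` is `O(Q / √N)`. -/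
lemma abs_coeff_le_div_sqrt {a : ℤ → ℝ} (ha : Summable a) {Q C N : ℝ} (hQ : 0 ≤ Q) (hC : 0 < C)
    (hN : 0 < N) (h : ∀ t ∈ Set.Ico (-(1 : ℝ) / 2) (1 / 2),
      ‖ft a t‖ ≤ Q * Real.exp (-(C / 2) * (N * t ^ 2))) (k : ℤ) :
    |a k| ≤ Q * √(2 * Real.pi / C) / √N := by
  refine (abs_coeff_le ha hQ (β := C / 2 * N) (by positivity) (fun t ht => ?_) k).trans
    (le_of_eq ?_)
  · convert h t ht using 3; ring
  · have : Real.pi / (C / 2 * N) = 2 * Real.pi / C / N := by field_simp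
    rw [this, Real.sqrt_div' _ hN.le, ← mul_div_assoc]

/-- Pointwise bounds on `μₙ`, `k² μₙ(k)` and the increments of `μₙ`. -/
lemma muN_bounds {ν : ℕ → ℤ → ℝ} (hprob : ∀ n, IsProbMeasure (ν n))
    (h2 : ∀ n, Summable (dil (dil (ν n)))) (hE : ∀ n, expectation (ν n) = 0)
    {K : ℝ} (hφ : ∀ n : ℕ, ∑ i ∈ Finset.range (n + 1), m2 (ν i) ≤ K * (n + 1))
    {C : ℝ} (hC : 0 < C) {N₀ : ℕ}
    (hft : ∀ n > N₀, ∀ t ∈ Set.Ico (-(1 : ℝ) / 2) (1 / 2),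
      ‖ft (ν n) t‖ ≤ Real.exp (-C * t ^ 2)) :
    ∃ M : ℝ, 0 < M ∧ ∀ (n : ℕ) (k : ℤ), muN ν n k ≤ M / √(n + 1) ∧
      (k : ℝ) ^ 2 * muN ν n k ≤ M * √(n + 1) ∧
      |muN ν n (k + 1) - muN ν n k| ≤ M / (n + 1) := by
  have hpi := Real.pi_pos
  have hK : 0 ≤ K := by
    have := hφ 0
    simp only [zero_add, Finset.range_one, Finset.sum_singleton, Nat.cast_zero, mul_one] at this
    exact (m2_nonneg (hprob 0)).trans this
  obtain ⟨E, hEdef⟩ : ∃ E, E = Real.exp (C / 4) := ⟨_, rfl⟩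
  have hE1 : 1 ≤ E := by rw [hEdef]; exact Real.one_le_exp (by positivity)
  have key : ∀ n : ℕ, ∀ t ∈ Set.Ico (-(1 : ℝ) / 2) (1 / 2),
      ‖ft (muN ν n) t‖ ≤ E ^ (N₀ + 1) * Real.exp (-C * ((n + 1) * t ^ 2)) ∧
      ‖ft (dil (dil (muN ν n))) t‖ ≤ E ^ 2 * ((K * (n + 1) + (2 * Real.pi * (K * (n + 1)) * |t|) ^ 2) *
        (E ^ (N₀ + 1) * Real.exp (-C * ((n + 1) * t ^ 2)))) := by
    intro n t ht
    have ht2 : t ^ 2 ≤ 1 / 4 := by nlinarith [ht.1, ht.2]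
    obtain ⟨w, hw⟩ : ∃ w, w = Real.exp (-C * t ^ 2) := ⟨_, rfl⟩
    have hw0 : 0 < w := by rw [hw]; exact Real.exp_pos _
    have hw1 : w ≤ 1 := by
      rw [hw, Real.exp_le_one_iff]; nlinarith [sq_nonneg t]
    have hEw : 1 ≤ E * w := by
      rw [hEdef, hw, ← Real.exp_add]; exact Real.one_le_exp (by nlinarith)
    have hwn : w ^ (n + 1) = Real.exp (-C * ((n + 1) * t ^ 2)) := by
      rw [hw, ← Real.exp_nat_mul]; congr 1; push_cast; ring
    obtain ⟨h0, -, h3⟩ := norm_ft_muN_le hprob h2 hE hw0.le hw1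
      (b := fun i => if i ≤ N₀ then E else 1) (t := t)
      (fun i => by split_ifs <;> simp [hE1]) (fun i => by
        split_ifs with hi
        · exact (norm_ft_le_one (hprob i) t).trans hEw
        · rw [one_mul, hw]; exact hft i (not_le.1 hi) t ht) n
    have hP := prod_ite_le_pow hE1 N₀ (n + 1)
    have hφ0 : 0 ≤ ∑ i ∈ Finset.range (n + 1), m2 (ν i) :=
      Finset.sum_nonneg fun i _ => m2_nonneg (hprob i)
    have hφn := hφ n
    rw [← hwn]
    refine ⟨h0.trans (by gcongr), ?_⟩
    calc ‖ft (dil (dil (muN ν n))) t‖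
        ≤ ‖ft (dil (dil (muN ν n))) t‖ * (E * w) ^ 2 :=
          le_mul_of_one_le_right (norm_nonneg _) (one_le_pow₀ hEw)
      _ = E ^ 2 * (‖ft (dil (dil (muN ν n))) t‖ * w ^ 2) := by ring
      _ ≤ _ := by
        refine mul_le_mul_of_nonneg_left (h3.trans ?_) (by positivity)
        gcongr
  obtain ⟨P, hPdef⟩ : ∃ P, P = E ^ (N₀ + 1) := ⟨_, rfl⟩
  have hP : 0 < P := by rw [hPdef]; positivity
  rw [← hPdef] at key
  obtain ⟨G, hG⟩ : ∃ G, G = √(2 * Real.pi / C) := ⟨_, rfl⟩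
  have hG0 : 0 < G := by rw [hG]; positivity
  obtain ⟨Q₁, hQ₁⟩ : ∃ Q, Q = 2 * Real.pi * P * (1 + 2 / C) := ⟨_, rfl⟩
  obtain ⟨Q₂, hQ₂⟩ : ∃ Q, Q = E ^ 2 * P * (K + 4 * Real.pi ^ 2 * K ^ 2 * (2 / C)) := ⟨_, rfl⟩
  have hQ₁0 : 0 < Q₁ := by rw [hQ₁]; positivity
  have hQ₂0 : 0 ≤ Q₂ := by rw [hQ₂]; positivity
  refine ⟨(P + Q₁ + Q₂) * G, by positivity, fun n k => ?_⟩
  have hμ := muN_isProbMeasure hprob n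
  obtain ⟨N, hN⟩ : ∃ N : ℝ, N = n + 1 := ⟨_, rfl⟩
  have hN0 : 0 < N := by rw [hN]; positivity
  replace key := key n
  rw [← hN] at key ⊢
  have hs0 : ∀ t : ℝ, 0 ≤ N * t ^ 2 := fun t => by positivity
  refine ⟨?_, ?_, ?_⟩
  · refine (le_abs_self _).trans ((abs_coeff_le_div_sqrt hμ.summable hP.le hC hN0
      (fun t ht => ?_) k).trans ?_)
    · exact (key t ht).1.trans (mul_le_mul_of_nonneg_left (exp_neg_le hC (hs0 t)) hP.le)
    · rw [← hG]; gcongr; linarith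
  · have h := abs_coeff_le_div_sqrt (summable_dil_dil_muN hprob h2 n)
      (Q := Q₂ * N) (by positivity) hC hN0 (fun t ht => (key t ht).2.trans ?_) k
    · simp only [dil_dil_eq, sq_abs] at h
      refine (le_abs_self _).trans (h.trans ?_)
      have e : Q₂ * N * √(2 * Real.pi / C) / √N = Q₂ * G * √N := by
        rw [← hG, div_eq_iff (by positivity), mul_assoc _ (√N), Real.mul_self_sqrt hN0.le]; ring
      rw [e]; gcongr; linarith
    · have e1 := exp_neg_le hC (hs0 t)
      have e2 := mul_exp_neg_le (s := N * t ^ 2) hC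
      calc E ^ 2 * ((K * N + (2 * Real.pi * (K * N) * |t|) ^ 2) *
            (P * Real.exp (-C * (N * t ^ 2))))
          = E ^ 2 * P * N * (K * Real.exp (-C * (N * t ^ 2)) +
            4 * Real.pi ^ 2 * K ^ 2 * ((N * t ^ 2) * Real.exp (-C * (N * t ^ 2)))) := by
            rw [mul_pow _ |t|, sq_abs]; ring
        _ ≤ E ^ 2 * P * N * (K * Real.exp (-(C / 2) * (N * t ^ 2)) +
            4 * Real.pi ^ 2 * K ^ 2 * (2 / C * Real.exp (-(C / 2) * (N * t ^ 2)))) := by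
            gcongr
        _ = _ := by rw [hQ₂]; ring
  · have hsum : Summable fun k => muN ν n (k + 1) - muN ν n k :=
      ((Equiv.addRight (1 : ℤ)).summable_iff.2 hμ.summable).sub hμ.summable
    have h := abs_coeff_le_div_sqrt hsum (Q := Q₁ / √N) (by positivity) hC hN0 (fun t ht => ?_) k
    · refine h.trans ?_
      rw [← hG]
      have e : Q₁ / √N * G / √N = Q₁ * G / N := by
        rw [div_mul_eq_mul_div, div_div, Real.mul_self_sqrt hN0.le]
      rw [e]; gcongr; linarith
    · have e1 := exp_neg_le hC (hs0 t)
      have e2 := mul_exp_neg_le (s := N * t ^ 2) hC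
      have e3 : |t| ≤ (1 + N * t ^ 2) / √N := by
        rw [le_div_iff₀ (by positivity)]
        have : (|t| * √N) ^ 2 = N * t ^ 2 := by
          rw [mul_pow, sq_abs, Real.sq_sqrt hN0.le]; ring
        nlinarith [sq_nonneg (|t| * √N - 1)]
      rw [ft_succ_sub hμ.summable, norm_mul]
      have h1 := norm_chr_sub_one_le t (-1)
      simp only [Int.reduceNeg, Int.cast_neg, Int.cast_one, abs_neg, abs_one, mul_one] at h1
      calc ‖ft (muN ν n) t‖ * ‖chr t (-1) - 1‖
          ≤ (P * Real.exp (-C * (N * t ^ 2))) * (2 * Real.pi * ((1 + N * t ^ 2) / √N)) := by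
            gcongr
            · exact (key t ht).1
            · exact h1.trans (by gcongr)
        _ = 2 * Real.pi * P / √N * (Real.exp (-C * (N * t ^ 2)) +
            (N * t ^ 2) * Real.exp (-C * (N * t ^ 2))) := by ring
        _ ≤ 2 * Real.pi * P / √N * (Real.exp (-(C / 2) * (N * t ^ 2)) +
            2 / C * Real.exp (-(C / 2) * (N * t ^ 2))) := by gcongr
        _ = _ := by rw [hQ₁]; ring

lemma sum_antitone_mul_le {p a : ℕ → ℝ} (hp : Antitone p) (hp0 : ∀ n, 0 ≤ p n) {l : ℝ}
    (ha : ∀ n : ℕ, ∑ k ∈ Finset.range n, a k ≤ l * n) (n : ℕ) :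
    ∑ k ∈ Finset.range n, p k * a k ≤ l * ∑ k ∈ Finset.range n, p k := by
  have key : ∀ n : ℕ, p n * (l * (n + 1) - ∑ k ∈ Finset.range (n + 1), a k) ≤
      ∑ k ∈ Finset.range (n + 1), p k * (l - a k) := by
    intro n
    induction n with
    | zero => simp
    | succ n ih =>
      have h1 := ha (n + 1)
      push_cast at h1
      rw [Finset.sum_range_succ, Finset.sum_range_succ _ (n + 1)]
      have h2 := mul_le_mul_of_nonneg_right (hp (Nat.le_add_right n 1)) (sub_nonneg.2 h1)
      push_cast
      linarith
  rcases n with - | n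
  · simp
  · have h1 := key n
    have h2 := ha (n + 1)
    push_cast at h2
    have h3 := (mul_nonneg (hp0 n) (sub_nonneg.2 h2)).trans h1
    simp only [mul_sub, Finset.sum_sub_distrib] at h3
    rw [Finset.mul_sum]
    simp only [mul_comm l]
    linarith

/-- A decreasing summable kernel at scale `L`. -/
noncomputable def ker (L : ℝ) (k : ℕ) : ℝ := L / ((L + k) * (L + k + 1))

lemma ker_antitone {L : ℝ} (hL : 0 < L) : Antitone (ker L) := by
  intro i j hij
  have : (i : ℝ) ≤ j := by exact_mod_cast hij
  unfold ker
  gcongr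

lemma ker_nonneg {L : ℝ} (hL : 0 < L) (k : ℕ) : 0 ≤ ker L k := by unfold ker; positivity

lemma sum_ker_le_one {L : ℝ} (hL : 0 < L) (n : ℕ) : ∑ k ∈ Finset.range n, ker L k ≤ 1 := by
  have : ∑ k ∈ Finset.range n, ker L k = 1 - L / (L + n) := by
    induction n with
    | zero => simp [hL.ne']
    | succ n ih =>
      rw [Finset.sum_range_succ, ih, ker]
      have h1 : L + n ≠ 0 := by positivity
      have h2 : L + n + 1 ≠ 0 := by positivity
      push_cast
      rw [← add_assoc]
      field_simp
      ring
  rw [this]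
  linarith [show 0 ≤ L / (L + n) by positivity]

/-- `OrbitBound a l`: all averages of `|a|` over the intervals `[0, n)` and `(-n, 0]` are at
most `l`. -/
def OrbitBound (a : ℤ → ℝ) (l : ℝ) : Prop :=
  ∀ n : ℕ, ∑ k ∈ Finset.range n, |a k| ≤ l * n ∧ ∑ k ∈ Finset.range n, |a (-k)| ≤ l * n

lemma sum_ker_mul_le {L M l : ℝ} (hL : 0 < L) (hM : 0 ≤ M) {r a : ℕ → ℝ}
    (hr : ∀ k, r k ≤ M * ker L k) (hl : 0 ≤ l)
    (ha : ∀ n : ℕ, ∑ k ∈ Finset.range n, |a k| ≤ l * n) (n : ℕ) :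
    ∑ k ∈ Finset.range n, r k * |a k| ≤ M * l := by
  calc ∑ k ∈ Finset.range n, r k * |a k| ≤ ∑ k ∈ Finset.range n, M * (ker L k * |a k|) := by
        refine Finset.sum_le_sum fun k _ => ?_
        rw [← mul_assoc]
        exact mul_le_mul_of_nonneg_right (hr k) (abs_nonneg _)
    _ = M * ∑ k ∈ Finset.range n, ker L k * |a k| := (Finset.mul_sum _ _ _).symm
    _ ≤ M * (l * ∑ k ∈ Finset.range n, ker L k) := by
        gcongr; exact sum_antitone_mul_le (ker_antitone hL) (ker_nonneg hL) ha n
    _ ≤ M * (l * 1) := by gcongr; exact sum_ker_le_one hL n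
    _ = M * l := by rw [mul_one]

lemma OrbitBound.average {L M l : ℝ} (hL : 0 < L) (hM : 0 ≤ M) {ρ a : ℤ → ℝ}
    (h0 : ∀ k, 0 ≤ ρ k) (hρ : ∀ k, ρ k ≤ M * ker L k.natAbs) (ha : OrbitBound a l) :
    Summable (fun k => ρ k * a k) ∧ |∑' k, ρ k * a k| ≤ 2 * M * l := by
  have hl : 0 ≤ l := by
    have := (ha 1).1
    simp only [Finset.range_one, Finset.sum_singleton, Nat.cast_one, mul_one] at this
    exact (abs_nonneg _).trans this
  have hpos := sum_ker_mul_le hL hM (r := fun k : ℕ => ρ k) (a := fun k : ℕ => a k)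
    (fun k => by simpa using hρ k) hl fun n => (ha n).1
  have hneg := sum_ker_mul_le hL hM (r := fun k : ℕ => ρ (-k)) (a := fun k : ℕ => a (-k))
    (fun k => by simpa using hρ (-k)) hl fun n => (ha n).2
  have hneg' : ∀ n : ℕ, ∑ k ∈ Finset.range n, ρ (-(k + 1 : ℤ)) * |a (-(k + 1 : ℤ))| ≤ M * l := by
    intro n
    refine le_trans ?_ (hneg (n + 1))
    rw [Finset.sum_range_succ']
    push_cast
    exact le_add_of_nonneg_right (mul_nonneg (h0 _) (abs_nonneg _))
  have s1 := summable_of_sum_range_le (fun k : ℕ => mul_nonneg (h0 k) (abs_nonneg (a k))) hpos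
  have s2 := summable_of_sum_range_le (fun k : ℕ => mul_nonneg (h0 (-(k + 1 : ℤ)))
    (abs_nonneg (a (-(k + 1 : ℤ))))) hneg'
  have t1 := Real.tsum_le_of_sum_range_le (fun k : ℕ => mul_nonneg (h0 k) (abs_nonneg (a k))) hpos
  have t2 := Real.tsum_le_of_sum_range_le (fun k : ℕ => mul_nonneg (h0 (-(k + 1 : ℤ)))
    (abs_nonneg (a (-(k + 1 : ℤ))))) hneg'
  have h := HasSum.of_nat_of_neg_add_one (f := fun k : ℤ => ρ k * |a k|) s1.hasSum s2.hasSum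
  have e : ∀ k, ‖ρ k * a k‖ ≤ ρ k * |a k| := fun k => by
    rw [norm_mul, Real.norm_eq_abs, Real.norm_eq_abs, abs_of_nonneg (h0 k)]
  refine ⟨Summable.of_norm_bounded h.summable e, ?_⟩
  refine (tsum_of_norm_bounded h e).trans ?_
  linarith

lemma le_ker_of_bounds {M N x : ℝ} (hN : 1 ≤ N) (k : ℤ) (h1 : x ≤ M / √N)
    (h2 : (k : ℝ) ^ 2 * x ≤ M * √N) (hx : 0 ≤ x) : x ≤ 8 * M * ker (√N) k.natAbs := by
  have hs : 1 ≤ √N := Real.one_le_sqrt.2 hN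
  have hk : (k : ℝ) ^ 2 = (k.natAbs : ℝ) ^ 2 := by
    rw [Nat.cast_natAbs, Int.cast_abs, sq_abs]
  rw [hk] at h2
  rw [ker]
  have h3 : (0 : ℝ) ≤ k.natAbs := Nat.cast_nonneg _
  generalize (k.natAbs : ℝ) = j at *
  generalize √N = s at *
  rw [← mul_div_assoc, le_div_iff₀ (by positivity)]
  rw [le_div_iff₀ (by positivity)] at h1
  have h4 : (s + j) * (s + j + 1) ≤ 4 * (s ^ 2 + j ^ 2) := by
    nlinarith [sq_nonneg (s - j), mul_nonneg (add_nonneg (zero_le_one.trans hs) h3)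
      (add_nonneg (sub_nonneg.2 hs) h3)]
  have h5 : x * s * s ≤ M * s := mul_le_mul_of_nonneg_right h1 (by positivity)
  nlinarith [mul_le_mul_of_nonneg_left h4 hx]

lemma tendsto_tsum_coboundary {ρ : ℕ → ℤ → ℝ} (hρ : ∀ n, IsProbMeasure (ρ n)) {M : ℝ} (hM : 0 < M)
    (h : ∀ (n : ℕ) (k : ℤ), ρ n k ≤ M / √(n + 1) ∧ (k : ℝ) ^ 2 * ρ n k ≤ M * √(n + 1) ∧
      |ρ n (k + 1) - ρ n k| ≤ M / (n + 1)) {g : ℤ → ℝ} {B : ℝ} (hg : ∀ k, |g k| ≤ B) :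
    (∀ n, Summable fun k => ρ n k * (g k - g (k + 1))) ∧
    Tendsto (fun n => ∑' k, ρ n k * (g k - g (k + 1))) atTop (nhds 0) := by
  have s1 : ∀ n, Summable fun k => ρ n k * g k := fun n =>
    Summable.of_norm_bounded ((hρ n).summable.mul_right B) fun k => by
      rw [norm_mul, Real.norm_eq_abs, Real.norm_eq_abs, abs_of_nonneg ((hρ n).1 k)]
      exact mul_le_mul_of_nonneg_left (hg k) ((hρ n).1 k)
  have s2 : ∀ n, Summable fun k => ρ n k * g (k + 1) := fun n =>
    Summable.of_norm_bounded ((hρ n).summable.mul_right B) fun k => by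
      rw [norm_mul, Real.norm_eq_abs, Real.norm_eq_abs, abs_of_nonneg ((hρ n).1 k)]
      exact mul_le_mul_of_nonneg_left (hg _) ((hρ n).1 k)
  refine ⟨fun n => by simpa only [mul_sub] using (s1 n).sub (s2 n), ?_⟩
  have e : ∀ n, ∑' k, ρ n k * (g k - g (k + 1)) =
      ∑' k, (ρ n (k + 1) - ρ n k) * g (k + 1) := fun n => by
    have s3 : HasSum (fun k => ρ n (k + 1) * g (k + 1)) (∑' k, ρ n k * g k) :=
      (Equiv.addRight (1 : ℤ)).hasSum_iff.2 (s1 n).hasSum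
    simp only [mul_sub, sub_mul]
    rw [(s1 n).tsum_sub (s2 n), s3.summable.tsum_sub (s2 n), s3.tsum_eq]
  simp_rw [e]
  have hB : 0 ≤ B := (abs_nonneg _).trans (hg 0)
  have hsum : Summable fun k : ℤ =>
      (3 * M * |(k : ℝ)| ^ (-(4 / 3 : ℝ)) + if k = 0 then M else 0) * B :=
    (((Real.summable_abs_int_rpow (by norm_num)).mul_left _).add
      (hasSum_ite_eq (0 : ℤ) M).summable).mul_right _
  have hlim : ∀ k : ℤ, Tendsto (fun n => (ρ n (k + 1) - ρ n k) * g (k + 1)) atTop (nhds 0) := by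
    intro k
    have h1 : Tendsto (fun n : ℕ => M * (1 / ((n : ℝ) + 1)) * B) atTop (nhds 0) := by
      simpa using (tendsto_one_div_add_atTop_nhds_zero_nat.const_mul M).mul_const B
    refine squeeze_zero_norm (fun n => ?_) h1
    rw [norm_mul, mul_one_div]
    exact mul_le_mul (h n k).2.2 (hg _) (norm_nonneg _) (by positivity)
  have := tendsto_tsum_of_dominated_convergence hsum hlim (Eventually.of_forall fun n k => ?_)
  · simpa using this
  · rw [norm_mul]
    refine mul_le_mul ?_ (hg _) (norm_nonneg _) ?_
    · rw [Real.norm_eq_abs]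
      obtain ⟨h1, h2, h3⟩ := h n k
      obtain ⟨h4, h5, -⟩ := h n (k + 1)
      have p1 := (hρ n).1 k
      have p2 := (hρ n).1 (k + 1)
      split_ifs with hk
      · refine h3.trans ?_
        have : M / ((n : ℝ) + 1) ≤ M := div_le_self hM.le (by linarith [n.cast_nonneg (α := ℝ)])
        have : 0 ≤ 3 * M * |(k : ℝ)| ^ (-(4 / 3 : ℝ)) := by positivity
        linarith
      · rw [add_zero, Real.rpow_neg (abs_nonneg _), ← div_eq_mul_inv]
        have hk0 : 0 < |(k : ℝ)| := by simpa using hk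
        rw [le_div_iff₀ (by positivity)]
        refine le_of_pow_le_pow_left₀ (n := 3) (by norm_num) (by positivity) ?_
        have hk4 : (|(k : ℝ)| ^ (4 / 3 : ℝ)) ^ 3 = ((k : ℝ) ^ 2) ^ 2 := by
          rw [← Real.rpow_natCast, ← Real.rpow_mul (abs_nonneg _),
            show (4 / 3 : ℝ) * ((3 : ℕ) : ℝ) = ((4 : ℕ) : ℝ) by norm_num, Real.rpow_natCast,
            ← pow_mul, Even.pow_abs ⟨2, rfl⟩]
        rw [mul_pow, hk4]
        push_cast at h5
        have hN : (1 : ℝ) ≤ n + 1 := by linarith [n.cast_nonneg (α := ℝ)]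
        have hs : 1 ≤ √((n : ℝ) + 1) := Real.one_le_sqrt.2 hN
        have hss : √((n : ℝ) + 1) ^ 2 = n + 1 := Real.sq_sqrt (by linarith)
        rw [← hss] at h3
        generalize √((n : ℝ) + 1) = s at *
        have hd : |ρ n (k + 1) - ρ n k| ≤ ρ n (k + 1) + ρ n k := by
          rw [abs_le]; constructor <;> linarith
        have h6 : M / s ≤ M * s := by
          rw [div_le_iff₀ (by positivity)]; nlinarith [mul_le_mul hs hs zero_le_one (by positivity)]
        have h7 : (k : ℝ) ^ 2 * |ρ n (k + 1) - ρ n k| ≤ 5 * (M * s) := by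
          calc (k : ℝ) ^ 2 * |ρ n (k + 1) - ρ n k|
              ≤ (k : ℝ) ^ 2 * (ρ n (k + 1) + ρ n k) := by gcongr
            _ ≤ (2 * ((k : ℝ) + 1) ^ 2 + 2) * ρ n (k + 1) + (k : ℝ) ^ 2 * ρ n k := by
              have : (k : ℝ) ^ 2 ≤ 2 * ((k : ℝ) + 1) ^ 2 + 2 := by nlinarith [sq_nonneg ((k : ℝ) + 2)]
              nlinarith [mul_le_mul_of_nonneg_right this p2]
            _ ≤ _ := by linarith
        calc |ρ n (k + 1) - ρ n k| ^ 3 * ((k : ℝ) ^ 2) ^ 2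
            = ((k : ℝ) ^ 2 * |ρ n (k + 1) - ρ n k|) ^ 2 * |ρ n (k + 1) - ρ n k| := by ring
          _ ≤ (5 * (M * s)) ^ 2 * (M / s ^ 2) := by gcongr
          _ = 25 * M ^ 3 := by field_simp; ring
          _ ≤ _ := by nlinarith [pow_pos hM 3]
    · split_ifs <;> positivity

section Maximal

variable {X : Type*}

/-- The maximum of the Birkhoff sums of `u` of length at most `N`. -/
noncomputable def maxSum (T : X → X) (u : X → ℝ) : ℕ → X → ℝ
  | 0 => fun _ => 0
  | N + 1 => fun x => max 0 (u x + maxSum T u N (T x))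

lemma maxSum_nonneg (T : X → X) (u : X → ℝ) (N : ℕ) (x : X) : 0 ≤ maxSum T u N x := by
  cases N with
  | zero => exact le_rfl
  | succ N => exact le_max_left _ _

lemma maxSum_mono (T : X → X) (u : X → ℝ) (x : X) : Monotone fun N => maxSum T u N x := by
  refine monotone_nat_of_le_succ fun N => ?_
  induction N generalizing x with
  | zero => exact le_max_left _ _
  | succ N ih => exact max_le_max le_rfl (by gcongr; exact ih (T x))

lemma sum_iterate_le_maxSum (T : X → X) (u : X → ℝ) (n : ℕ) (x : X) :
    ∑ k ∈ Finset.range n, u (T^[k] x) ≤ maxSum T u n x := by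
  induction n generalizing x with
  | zero => exact le_rfl
  | succ n ih =>
    rw [Finset.sum_range_succ', add_comm]
    exact le_max_of_le_right (by simpa using ih (T x))

variable [MeasurableSpace X] {m : Measure X} {T : X → X}

lemma integrable_maxSum (hT : MeasurePreserving T m m) {u : X → ℝ} (hu : Integrable u m) (N : ℕ) :
    Integrable (maxSum T u N) m := by
  induction N with
  | zero => exact integrable_zero _ _ _
  | succ N ih => exact (integrable_zero _ _ _).sup (hu.add (hT.integrable_comp_of_integrable ih))

/-- The maximal ergodic lemma. -/
lemma setIntegral_maxSum_nonneg (hT : MeasurePreserving T m m) {u : X → ℝ} (hu : Integrable u m)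
    (N : ℕ) : 0 ≤ ∫ x in {x | 0 < maxSum T u (N + 1) x}, u x ∂m := by
  have hi := integrable_maxSum hT hu
  have hnull : NullMeasurableSet {x | 0 < maxSum T u (N + 1) x} m :=
    nullMeasurableSet_lt aemeasurable_const (hi (N + 1)).aemeasurable
  rw [← integral_indicator₀ hnull]
  have hiT : Integrable (fun x => maxSum T u N (T x)) m := hT.integrable_comp_of_integrable (hi N)
  have hcomp : ∫ x, maxSum T u N (T x) ∂m = ∫ x, maxSum T u N x ∂m := by
    have h := integral_map (μ := m) hT.aemeasurable (f := maxSum T u N)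
      (by rw [hT.map_eq]; exact (hi N).aestronglyMeasurable)
    rw [hT.map_eq] at h
    exact h.symm
  calc 0 ≤ ∫ x, maxSum T u (N + 1) x ∂m - ∫ x, maxSum T u N x ∂m :=
        sub_nonneg.2 (integral_mono (hi N) (hi (N + 1)) fun x => maxSum_mono T u x N.le_succ)
    _ = ∫ x, (maxSum T u (N + 1) x - maxSum T u N (T x)) ∂m := by
        rw [integral_sub (hi _) hiT, hcomp]
    _ ≤ _ := by
        refine integral_mono ((hi _).sub hiT)
          (hu.indicator₀ hnull) fun x => ?_
        by_cases hx : 0 < maxSum T u (N + 1) x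
        · rw [Set.indicator_of_mem (by exact hx)]
          have h1 : maxSum T u (N + 1) x = max 0 (u x + maxSum T u N (T x)) := rfl
          rcases max_choice 0 (u x + maxSum T u N (T x)) with h | h
          · rw [h1, h] at hx; exact absurd hx (lt_irrefl _)
          · simp only [h1, h]; linarith
        · rw [Set.indicator_of_notMem (by exact hx)]
          have h1 := maxSum_nonneg T u N (T x)
          simp only
          linarith

variable [IsProbabilityMeasure m]

/-- The weak type `(1, 1)` maximal inequality for ergodic averages. -/
lemma measure_maximal_le (hT : MeasurePreserving T m m) {f : X → ℝ} (hf : Integrable f m) {l : ℝ}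
    (hl : 0 < l) :
    m {x | ∃ n : ℕ, l * n < ∑ k ∈ Finset.range n, |f (T^[k] x)|} ≤
      ENNReal.ofReal ((∫ x, |f x| ∂m) / l) := by
  set u : X → ℝ := fun x => |f x| - l with hu_def
  have hu : Integrable u m := hf.abs.sub (integrable_const l)
  set s : ℕ → Set X := fun N => {x | 0 < maxSum T u (N + 1) x} with hs
  have hmono : Monotone s := fun i j hij x hx =>
    lt_of_lt_of_le hx (maxSum_mono T u x (Nat.succ_le_succ hij))
  have hsub : {x | ∃ n : ℕ, l * n < ∑ k ∈ Finset.range n, |f (T^[k] x)|} ⊆ ⋃ N, s N := by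
    rintro x ⟨n, hn⟩
    refine Set.mem_iUnion.2 ⟨n, ?_⟩
    have h1 := sum_iterate_le_maxSum T u n x
    simp only [hu_def, Finset.sum_sub_distrib, Finset.sum_const, Finset.card_range,
      nsmul_eq_mul] at h1
    exact lt_of_lt_of_le (by linarith) (maxSum_mono T u x n.le_succ)
  refine (measure_mono hsub).trans ?_
  rw [hmono.measure_iUnion]
  refine iSup_le fun N => ?_
  have h0 := setIntegral_maxSum_nonneg hT hu N
  rw [← ofReal_measureReal]
  refine ENNReal.ofReal_le_ofReal ?_
  rw [le_div_iff₀ hl]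
  change 0 ≤ ∫ x in s N, u x ∂m at h0
  rw [integral_sub hf.abs.integrableOn (integrable_const l).integrableOn, setIntegral_const,
    smul_eq_mul] at h0
  have h1 : ∫ x in s N, |f x| ∂m ≤ ∫ x, |f x| ∂m :=
    setIntegral_le_integral hf.abs (Eventually.of_forall fun x => abs_nonneg _)
  linarith

lemma measure_not_orbitBound_le {τ : Equiv.Perm X} (hτ : MeasurePreserving (τ : X → X) m m)
    (hτ' : MeasurePreserving (τ.symm : X → X) m m) {f : X → ℝ} (hf : Integrable f m) {l : ℝ}
    (hl : 0 < l) :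
    m {x | ¬ OrbitBound (fun k => f ((τ ^ k) x)) l} ≤
      2 * ENNReal.ofReal ((∫ x, |f x| ∂m) / l) := by
  have h1 := measure_maximal_le hτ hf hl
  have h2 := measure_maximal_le hτ' hf hl
  rw [two_mul]
  refine (measure_mono fun x hx => ?_).trans ((measure_union_le _ _).trans (add_le_add h1 h2))
  by_contra hcon
  simp only [Set.mem_union, Set.mem_ofPred_eq, not_or, not_exists, not_lt] at hcon
  have e1 : ∀ k : ℕ, (τ ^ (k : ℤ)) x = τ^[k] x := fun k => by
    rw [zpow_natCast, Equiv.Perm.iterate_eq_pow]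
  have e2 : ∀ k : ℕ, (τ ^ (-(k : ℤ))) x = τ.symm^[k] x := fun k => by
    rw [zpow_neg, zpow_natCast, ← inv_pow, Equiv.Perm.iterate_eq_pow]; rfl
  refine hx fun n => ⟨?_, ?_⟩
  · simpa only [e1] using hcon.1 n
  · simpa only [e2] using hcon.2 n

end Maximal

/-- Local-limit type bounds for a sequence of probability measures on `ℤ`. -/
structure LocalBounds (ρ : ℕ → ℤ → ℝ) (M : ℝ) : Prop where
  isProbMeasure : ∀ n, IsProbMeasure (ρ n)
  pos : 0 < M
  bound : ∀ (n : ℕ) (k : ℤ), ρ n k ≤ M / √(n + 1) ∧ (k : ℝ) ^ 2 * ρ n k ≤ M * √(n + 1) ∧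
    |ρ n (k + 1) - ρ n k| ≤ M / (n + 1)

lemma LocalBounds.average {ρ : ℕ → ℤ → ℝ} {M : ℝ} (h : LocalBounds ρ M) {a : ℤ → ℝ} {l : ℝ}
    (ha : OrbitBound a l) (n : ℕ) :
    Summable (fun k => ρ n k * a k) ∧ |∑' k, ρ n k * a k| ≤ 16 * M * l := by
  have hM := h.pos
  have := OrbitBound.average (L := √((n : ℝ) + 1)) (M := 8 * M) (by positivity) (by positivity)
    (h.isProbMeasure n).1
    (fun k => le_ker_of_bounds (by simp) k (h.bound n k).1 (h.bound n k).2.1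
      ((h.isProbMeasure n).1 k)) ha
  exact ⟨this.1, this.2.trans_eq (by ring)⟩

/-- In a Hilbert space, every vector is a limit of sums of a fixed vector and a coboundary. -/
lemma exists_fixed_add_coboundary {E : Type*} [NormedAddCommGroup E] [InnerProductSpace ℝ E]
    [CompleteSpace E] (U : E →L[ℝ] E) (hU : ‖U‖ ≤ 1) (x : E) {ε : ℝ} (hε : 0 < ε) :
    ∃ h y : E, U h = h ∧ ‖x - (h + (y - U y))‖ ≤ ε := by
  have ht := U.tendsto_birkhoffAverage_orthogonalProjection hU x
  set h := (U.eqLocus (1 : E →L[ℝ] E)).orthogonalProjectionOnto x with hh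
  obtain ⟨n, hn, hn0⟩ := ((Metric.tendsto_nhds.1 ht ε hε).and (eventually_gt_atTop 0)).exists
  let R := LinearMap.range ((1 - U : E →L[ℝ] E) : E →ₗ[ℝ] E)
  have hR : ∀ k : ℕ, x - U^[k] x ∈ R := fun k => by
    induction k with
    | zero => simp
    | succ k ih =>
      have : x - U^[k + 1] x = (x - U^[k] x) + (U^[k] x - U (U^[k] x)) := by
        rw [Function.iterate_succ_apply']; abel
      rw [this]
      exact R.add_mem ih ⟨U^[k] x, by simp⟩
  have hA : x - birkhoffAverage ℝ U _root_.id n x ∈ R := by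
    have hn' : (n : ℝ) ≠ 0 := by positivity
    have : x - birkhoffAverage ℝ U _root_.id n x =
        (n : ℝ)⁻¹ • ∑ k ∈ Finset.range n, (x - U^[k] x) := by
      rw [Finset.sum_sub_distrib, smul_sub, Finset.sum_const, Finset.card_range,
        ← Nat.cast_smul_eq_nsmul ℝ, smul_smul, inv_mul_cancel₀ hn', one_smul]
      rfl
    rw [this]
    exact R.smul_mem _ (R.sum_mem fun k _ => hR k)
  obtain ⟨y, hy⟩ := hA
  refine ⟨h, y, by simpa using h.2, ?_⟩
  have hy' : y - U y = x - birkhoffAverage ℝ U _root_.id n x := by simpa using hy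
  rw [hy', dist_eq_norm] at *
  rw [show x - ((h : E) + (x - birkhoffAverage ℝ U _root_.id n x)) =
    birkhoffAverage ℝ U _root_.id n x - h by abel]
  exact hn.le

section Convergence

variable {X : Type*} [MeasurableSpace X] {m : Measure X}
  {τ : Equiv.Perm X} {ρ : ℕ → ℤ → ℝ} {M : ℝ} {f g : X → ℝ}

/-- Almost everywhere convergence of the weighted averages of `f` along the orbits of `τ`. -/
def ConvAE (ρ : ℕ → ℤ → ℝ) (τ : Equiv.Perm X) (m : Measure X) (f : X → ℝ) : Prop :=
  ∀ᵐ x ∂m, ∃ L : ℝ, Tendsto (fun n => ∑' k : ℤ, ρ n k * f ((τ ^ k) x)) atTop (nhds L)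

lemma ConvAE.of_fixed (hρ : LocalBounds ρ M) (hτ : MeasurePreserving (τ : X → X) m m)
    (hτ' : MeasurePreserving (τ.symm : X → X) m m) (hf : (fun x => f (τ x)) =ᵐ[m] f) :
    ConvAE ρ τ m f := by
  have hpow : ∀ k : ℤ, MeasurePreserving ((τ ^ k : Equiv.Perm X) : X → X) m m := fun k => by
    obtain ⟨n, rfl | rfl⟩ := k.eq_nat_or_neg
    · rw [zpow_natCast, ← Equiv.Perm.iterate_eq_pow]
      exact hτ.iterate n
    · rw [zpow_neg, zpow_natCast, ← inv_pow, ← Equiv.Perm.iterate_eq_pow]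
      exact hτ'.iterate n
  have hall : ∀ᵐ x ∂m, ∀ k : ℤ, f (τ ((τ ^ k) x)) = f ((τ ^ k) x) :=
    ae_all_iff.2 fun k => (hpow k).quasiMeasurePreserving.ae hf
  filter_upwards [hall] with x hx
  have hstep : ∀ k : ℤ, f ((τ ^ (k + 1)) x) = f ((τ ^ k) x) := fun k => by
    rw [← hx k, add_comm, zpow_one_add, Equiv.Perm.mul_apply]
  have hconst : ∀ k : ℤ, f ((τ ^ k) x) = f x := fun k => by
    induction k with
    | zero => simp
    | succ k ih => rw [hstep, ih]
    | pred k ih => rw [← ih, ← hstep, sub_add_cancel]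
  refine ⟨f x, ?_⟩
  simp only [hconst, tsum_mul_right, (hρ.isProbMeasure _).2.tsum_eq, one_mul, tendsto_const_nhds]

lemma ConvAE.sub_comp_of_bounded (hρ : LocalBounds ρ M) {B : ℝ} (hg : ∀ x, |g x| ≤ B) :
    ConvAE ρ τ m fun x => g x - g (τ x) := by
  refine Eventually.of_forall fun x => ⟨0, ?_⟩
  have := (tendsto_tsum_coboundary hρ.isProbMeasure hρ.pos hρ.bound
    (g := fun k => g ((τ ^ k) x)) fun k => hg _).2
  simpa only [add_comm _ (1 : ℤ), zpow_one_add, Equiv.Perm.mul_apply] using this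

variable [IsProbabilityMeasure m]

lemma integral_abs_sub_le {p : ENNReal} (hp : 1 ≤ p) (hf : Integrable f m) (hg : Integrable g m)
    {ε : ℝ} (hε : 0 ≤ ε) (h : eLpNorm (f - g) p m ≤ ENNReal.ofReal ε) :
    ∫ x, |f x - g x| ∂m ≤ ε := by
  have h1 : eLpNorm (f - g) 1 m ≤ ENNReal.ofReal ε :=
    (eLpNorm_le_eLpNorm_of_exponent_le hp (hf.sub hg).aestronglyMeasurable).trans h
  have h2 := integral_norm_eq_lintegral_enorm (hf.sub hg).aestronglyMeasurable
  rw [← eLpNorm_one_eq_lintegral_enorm] at h2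
  exact h2.trans_le (ENNReal.toReal_le_of_le_ofReal hε h1)

lemma ae_exists_orbitBound (hτ : MeasurePreserving (τ : X → X) m m)
    (hτ' : MeasurePreserving (τ.symm : X → X) m m) (hf : Integrable f m) :
    ∀ᵐ x ∂m, ∃ l, OrbitBound (fun k => f ((τ ^ k) x)) l := by
  rw [ae_iff, ← nonpos_iff_eq_zero]
  refine ENNReal.le_of_forall_pos_le_add fun δ hδ _ => ?_
  have hI : 0 ≤ ∫ x, |f x| ∂m := integral_nonneg fun x => abs_nonneg _
  have hδ' : (0 : ℝ) < δ := hδ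
  have hl : 0 < 2 * ((∫ x, |f x| ∂m) + 1) / δ := by positivity
  refine (measure_mono fun x hx => ?_).trans
    ((measure_not_orbitBound_le hτ hτ' hf hl).trans ?_)
  · simp only [Set.mem_ofPred_eq, not_exists] at hx ⊢
    exact hx _
  · rw [zero_add, ← ENNReal.ofReal_coe_nnreal, ← ENNReal.ofReal_ofNat, ← ENNReal.ofReal_mul (by simp)]
    refine ENNReal.ofReal_le_ofReal ?_
    rw [div_div_eq_mul_div, ← mul_div_assoc, div_le_iff₀ (by positivity)]
    nlinarith

lemma ConvAE.of_approx (hρ : LocalBounds ρ M) (hτ : MeasurePreserving (τ : X → X) m m)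
    (hτ' : MeasurePreserving (τ.symm : X → X) m m) (hf : Integrable f m)
    (h : ∀ ε : ℝ, 0 < ε → ∃ g, Integrable g m ∧ ConvAE ρ τ m g ∧ ∫ x, |f x - g x| ∂m ≤ ε) :
    ConvAE ρ τ m f := by
  have hM := hρ.pos
  have key : ∀ j : ℕ, ∀ᵐ x ∂m, ∃ N, ∀ n ≥ N,
      dist (∑' k : ℤ, ρ n k * f ((τ ^ k) x)) (∑' k : ℤ, ρ N k * f ((τ ^ k) x)) < 1 / ((j : ℝ) + 1) := by
    intro j
    rw [ae_iff, ← nonpos_iff_eq_zero]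
    refine ENNReal.le_of_forall_pos_le_add fun δ hδ _ => ?_
    have hδ' : (0 : ℝ) < δ := hδ
    set η : ℝ := 1 / ((j : ℝ) + 1) with hη
    have hη0 : 0 < η := by positivity
    obtain ⟨g, hg, hgc, hfg⟩ := h (η / (64 * M) * δ / 2) (by positivity)
    have hl : 0 < η / (64 * M) := by positivity
    have hbad := measure_not_orbitBound_le hτ hτ' (hf.sub hg) hl
    have hgood := hgc.and (ae_exists_orbitBound hτ hτ' hg)
    rw [ae_iff] at hgood
    have hle : m {x | ¬ OrbitBound (fun k => (f - g) ((τ ^ k) x)) (η / (64 * M))} ≤ δ := by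
      refine hbad.trans ?_
      rw [← ENNReal.ofReal_coe_nnreal, ← ENNReal.ofReal_ofNat, ← ENNReal.ofReal_mul (by simp)]
      refine ENNReal.ofReal_le_ofReal ?_
      rw [← mul_div_assoc, div_le_iff₀ hl]
      simp only [Pi.sub_apply]
      linarith
    rw [zero_add]
    refine (measure_mono fun x hx => ?_).trans ((measure_union_le _ _).trans
      ((add_le_add hgood.le hle).trans_eq (zero_add _)))
    by_contra hcon
    simp only [Set.mem_union, Set.mem_ofPred_eq, not_or, not_not] at hcon
    obtain ⟨⟨⟨L, hL⟩, l, hgl⟩, hfgl⟩ := hcon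
    have hsplit : ∀ n, ∑' k : ℤ, ρ n k * f ((τ ^ k) x) =
        ∑' k : ℤ, ρ n k * g ((τ ^ k) x) + ∑' k : ℤ, ρ n k * (f - g) ((τ ^ k) x) := fun n => by
      rw [← (hρ.average hgl n).1.tsum_add (hρ.average hfgl n).1]
      refine tsum_congr fun k => ?_
      simp only [Pi.sub_apply]; ring
    obtain ⟨N, hN⟩ := Metric.cauchySeq_iff'.1 hL.cauchySeq (η / 2) (by positivity)
    refine hx ⟨N, fun n hn => ?_⟩
    have h1 := (hρ.average hfgl n).2
    have h2 := (hρ.average hfgl N).2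
    have h3 := hN n hn
    have e : 16 * M * (η / (64 * M)) = η / 4 := by field_simp; norm_num
    rw [e] at h1 h2
    rw [Real.dist_eq] at h3 ⊢
    rw [hsplit, hsplit]
    rw [abs_lt] at *
    rw [abs_le] at *
    constructor <;> linarith [h1.1, h1.2, h2.1, h2.2, h3.1, h3.2]
  filter_upwards [ae_all_iff.2 key] with x hx
  refine cauchySeq_tendsto_of_complete (Metric.cauchySeq_iff'.2 fun ε hε => ?_)
  obtain ⟨j, hj⟩ := exists_nat_one_div_lt hε
  obtain ⟨N, hN⟩ := hx j
  exact ⟨N, fun n hn => (hN n hn).trans hj⟩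

lemma ConvAE.add (hρ : LocalBounds ρ M) (hτ : MeasurePreserving (τ : X → X) m m)
    (hτ' : MeasurePreserving (τ.symm : X → X) m m) (hf : Integrable f m) (hg : Integrable g m)
    (hfc : ConvAE ρ τ m f) (hgc : ConvAE ρ τ m g) : ConvAE ρ τ m fun x => f x + g x := by
  filter_upwards [hfc, hgc, ae_exists_orbitBound hτ hτ' hf, ae_exists_orbitBound hτ hτ' hg]
    with x ⟨L, hL⟩ ⟨L', hL'⟩ ⟨l, hl⟩ ⟨l', hl'⟩
  refine ⟨L + L', (hL.add hL').congr fun n => ?_⟩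
  rw [← (hρ.average hl n).1.tsum_add (hρ.average hl' n).1]
  simp only [mul_add]

lemma ConvAE.sub_comp (hρ : LocalBounds ρ M) (hτ : MeasurePreserving (τ : X → X) m m)
    (hτ' : MeasurePreserving (τ.symm : X → X) m m) (hg : Integrable g m) :
    ConvAE ρ τ m fun x => g x - g (τ x) := by
  have hcomp : ∀ {u : X → ℝ}, Integrable u m → Integrable (fun x => u (τ x)) m :=
    fun hu => hτ.integrable_comp_of_integrable hu
  refine ConvAE.of_approx hρ hτ hτ' (hg.sub (hcomp hg)) fun ε hε => ?_
  obtain ⟨s, hs, hsm⟩ := (memLp_one_iff_integrable.2 hg).exists_simpleFunc_eLpNorm_sub_lt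
    ENNReal.one_ne_top (ε := ENNReal.ofReal (ε / 2)) (by simpa using hε)
  have hsi := memLp_one_iff_integrable.1 hsm
  obtain ⟨B, hB⟩ := s.exists_forall_norm_le
  refine ⟨fun x => s x - s (τ x), hsi.sub (hcomp hsi), ConvAE.sub_comp_of_bounded hρ hB, ?_⟩
  have h1 := integral_abs_sub_le le_rfl hg hsi (by positivity) hs.le
  have hd : Integrable (fun x => |g x - s x|) m := (hg.sub hsi).abs
  have h2 : ∫ x, |g (τ x) - s (τ x)| ∂m = ∫ x, |g x - s x| ∂m := by
    have h := integral_map (μ := m) hτ.aemeasurable (f := fun x => |g x - s x|)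
      (by rw [hτ.map_eq]; exact hd.aestronglyMeasurable)
    rw [hτ.map_eq] at h
    exact h.symm
  calc ∫ x, |g x - g (τ x) - (s x - s (τ x))| ∂m
      ≤ ∫ x, (|g x - s x| + |g (τ x) - s (τ x)|) ∂m := by
        refine integral_mono ((hg.sub (hcomp hg)).sub (hsi.sub (hcomp hsi))).abs
          (hd.add (hcomp hd)) fun x => ?_
        rw [show g x - g (τ x) - (s x - s (τ x)) = (g x - s x) - (g (τ x) - s (τ x)) by ring]
        exact abs_sub _ _
    _ ≤ ε := by rw [integral_add hd (hcomp hd), h2]; linarith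

lemma ConvAE.of_memLp_two (hρ : LocalBounds ρ M) (hτ : MeasurePreserving (τ : X → X) m m)
    (hτ' : MeasurePreserving (τ.symm : X → X) m m) (hf : MemLp f 2 m) : ConvAE ρ τ m f := by
  have hi : ∀ u : Lp ℝ 2 m, Integrable u m := fun u => (Lp.memLp u).integrable one_le_two
  refine ConvAE.of_approx hρ hτ hτ' (hf.integrable one_le_two) fun ε hε => ?_
  let U := (Lp.compMeasurePreservingₗᵢ (E := ℝ) (p := 2) ℝ (τ : X → X) hτ).toContinuousLinearMap
  have hU : ∀ u : Lp ℝ 2 m, U u =ᵐ[m] fun x => u (τ x) := fun u =>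
    Lp.coeFn_compMeasurePreserving u hτ
  obtain ⟨h, y, hh, hn⟩ := exists_fixed_add_coboundary U (LinearIsometry.norm_toContinuousLinearMap_le _)
    (hf.toLp f) hε
  have hhc : ConvAE ρ τ m h := ConvAE.of_fixed hρ hτ hτ' ((hU h).symm.trans (by rw [hh]))
  have hyi : Integrable (fun x => y (τ x)) m := hτ.integrable_comp_of_integrable (hi y)
  refine ⟨fun x => h x + (y x - y (τ x)), (hi h).add ((hi y).sub hyi),
    ConvAE.add hρ hτ hτ' (hi h) ((hi y).sub hyi) hhc (ConvAE.sub_comp hρ hτ hτ' (hi y)), ?_⟩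
  refine integral_abs_sub_le one_le_two (hf.integrable one_le_two) ((hi h).add ((hi y).sub hyi))
    hε.le ?_
  have hae : (f - fun x => h x + (y x - y (τ x))) =ᵐ[m] (hf.toLp f - (h + (y - U y)) : Lp ℝ 2 m) := by
    filter_upwards [Lp.coeFn_sub (hf.toLp f) (h + (y - U y)), Lp.coeFn_add h (y - U y),
      Lp.coeFn_sub y (U y), hU y, hf.coeFn_toLp] with x h1 h2 h3 h4 h5
    rw [h1, Pi.sub_apply, Pi.sub_apply, h2, Pi.add_apply, h3, Pi.sub_apply, h4, h5]
  refine (eLpNorm_congr_ae hae).trans_le ?_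
  rw [← ENNReal.ofReal_toReal (Lp.eLpNorm_ne_top _), ← Lp.norm_def]
  exact ENNReal.ofReal_le_ofReal hn

lemma ConvAE.of_integrable (hρ : LocalBounds ρ M) (hτ : MeasurePreserving (τ : X → X) m m)
    (hτ' : MeasurePreserving (τ.symm : X → X) m m) (hf : Integrable f m) : ConvAE ρ τ m f := by
  refine ConvAE.of_approx hρ hτ hτ' hf fun ε hε => ?_
  obtain ⟨s, hs, hsm⟩ := (memLp_one_iff_integrable.2 hf).exists_simpleFunc_eLpNorm_sub_lt
    ENNReal.one_ne_top (ε := ENNReal.ofReal ε) (by simpa using hε)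
  have hsi := memLp_one_iff_integrable.1 hsm
  exact ⟨s, hsi, ConvAE.of_memLp_two hρ hτ hτ' (s.memLp_of_isFiniteMeasure 2 m),
    integral_abs_sub_le le_rfl hf hsi hε.le hs.le⟩

end Convergence

end ConvAverages

/-- Theorem 2.2.2: under the hypotheses of Theorem 2.1.3 on the sequence
`ν`, for every invertible measure-preserving transformation `τ` of a probability space and
every `f ∈ L¹`, the averages `μ_n f(x) = ∑_k μ_n(k) f(τ^k x)` converge for a.e. `x`,
where `μ_n = ν_0 ∗ ⋯ ∗ ν_n`. -/
theorem ae_convergence_of_convolution_averages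
    (ν : ℕ → ℤ → ℝ)
    (hprob : ∀ n, IsProbMeasure (ν n))
    (hap : ∀ n, StrictlyAperiodic (ν n))
    (hE : ∀ n, expectation (ν n) = 0)
    (hm2 : ∀ n, Summable fun k : ℤ => |(k : ℝ)| ^ 2 * ν n k)
    (hφ : ∃ K : ℝ, ∀ n : ℕ, ∑ i ∈ Finset.range (n + 1), m2 (ν i) ≤ K * (n + 1))
    (C : ℝ) (hC : 0 < C) (N₀ : ℕ)
    (hft : ∀ n > N₀, ∀ t ∈ Set.Ico (-(1 : ℝ) / 2) (1 / 2),
      ‖ft (ν n) t‖ ≤ Real.exp (-C * t ^ 2)) :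
    ∀ (X : Type) [MeasurableSpace X] (m : Measure X), IsProbabilityMeasure m →
      ∀ τ : Equiv.Perm X, Measurable (τ : X → X) → Measurable (τ.symm : X → X) →
        MeasurePreserving (τ : X → X) m m →
        ∀ f : X → ℝ, Integrable f m →
          ∀ᵐ x ∂m, ∃ L : ℝ,
            Filter.Tendsto (fun n => ∑' k : ℤ, muN ν n k * f ((τ ^ k) x))
              Filter.atTop (nhds L) := by
  intro X _ m hm τ hτm hτm' hτ f hf
  obtain ⟨K, hK⟩ := hφ
  have h2 : ∀ n, Summable (ConvAverages.dil (ConvAverages.dil (ν n))) := fun n => by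
    rw [ConvAverages.dil_dil_eq]; exact hm2 n
  obtain ⟨M, hM, hb⟩ := ConvAverages.muN_bounds hprob h2 hE hK hC hft
  let e : X ≃ᵐ X := ⟨τ, hτm, hτm'⟩
  have hτ' : MeasurePreserving (τ.symm : X → X) m m := MeasurePreserving.symm e hτ
  exact ConvAverages.ConvAE.of_integrable
    ⟨fun n => ConvAverages.muN_isProbMeasure hprob n, hM, hb⟩ hτ hτ' hf
end
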